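/- arXiv:1710.07852 — 2 statements merged into one kernel-verified Lean document; each statement's English description precedes it below -/
import Mathlib

section
/- Let X and Y be real Banach spaces and suppose there exists a map f : X → Y which is weakly sequentially continuous, coarse, and satisfies Property (*). Then there exists a constant c > 0 such that for every normalized weakly null sequence (x_n) in X, every real Banach space (S, ‖·‖_S), every sequence (e_n) in S which is a spreading model of (x_n), and every k ∈ ℕ, one has c · inf{λ > 0 : k · δ̄_Y(1/λ) ≤ 1} ≤ ‖e_1 + … + e_k‖_S. -/
open Filter

/-- A map between normed spaces is *coarse* if points at distance at most `t`
are mapped to points at uniformly bounded distance. -/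
def Coarse {X Y : Type*} [NormedAddCommGroup X] [NormedAddCommGroup Y]
    (f : X → Y) : Prop :=
  ∀ t : ℝ, 0 ≤ t → ∃ C : ℝ, ∀ x y : X, ‖x - y‖ ≤ t → ‖f x - f y‖ ≤ C

/-- Property (*): there are `0 < α < β` and `b > 0` such that points at distance
in `[α, β]` are mapped to points at distance at least `b`. -/
def PropertyStar {X Y : Type*} [NormedAddCommGroup X] [NormedAddCommGroup Y]
    (f : X → Y) : Prop :=
  ∃ α β b : ℝ, 0 < α ∧ α < β ∧ 0 < b ∧
    ∀ x y : X, α ≤ ‖x - y‖ → ‖x - y‖ ≤ β → b ≤ ‖f x - f y‖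

/-- A map is weakly sequentially continuous if it sends weakly convergent
sequences to weakly convergent sequences. -/
def WeakSeqCont {X Y : Type*} [NormedAddCommGroup X] [NormedSpace ℝ X]
    [NormedAddCommGroup Y] [NormedSpace ℝ Y] (f : X → Y) : Prop :=
  ∀ (x : ℕ → X) (x₀ : X),
    (∀ φ : X →L[ℝ] ℝ, Tendsto (fun n => φ (x n)) atTop (nhds (φ x₀))) →
    ∀ ψ : Y →L[ℝ] ℝ, Tendsto (fun n => ψ (f (x n))) atTop (nhds (ψ (f x₀)))

/-- The modulus of asymptotic uniform convexity `δ̄_Y(t)`. -/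
noncomputable def AUCmod (Y : Type*) [NormedAddCommGroup Y] [NormedSpace ℝ Y] (t : ℝ) : ℝ :=
  sInf { r : ℝ | ∃ x : Y, ‖x‖ = 1 ∧
    r = sSup { s : ℝ | ∃ E : Subspace ℝ Y, IsClosed (E : Set Y) ∧
      FiniteDimensional ℝ (Y ⧸ E) ∧
      s = sInf { u : ℝ | ∃ y : Y, y ∈ E ∧ ‖y‖ = 1 ∧ u = ‖x + t • y‖ - 1 } } }

/-- `(e_n)` in `S` is a spreading model of the bounded sequence `(x_n)` in `X`. -/
def IsSpreadingModel {X S : Type*} [NormedAddCommGroup X] [NormedSpace ℝ X]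
    [NormedAddCommGroup S] [NormedSpace ℝ S] (x : ℕ → X) (e : ℕ → S) : Prop :=
  ∀ ε : ℝ, 0 < ε → ∀ k : ℕ, ∃ ℓ : ℕ, ∀ n : Fin k → ℕ,
    StrictMono n → (∀ i, ℓ ≤ n i) → ∀ a : Fin k → ℝ, (∀ i, |a i| ≤ 1) →
      |‖∑ i, a i • x (n i)‖ - ‖∑ i, a i • e (i : ℕ)‖| ≤ ε

lemma Coarse.exists_bound {X Y : Type*} [NormedAddCommGroup X] [NormedSpace ℝ X]
    [NormedAddCommGroup Y] {f : X → Y} (hf : Coarse f) :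
    ∃ L : ℝ, 0 < L ∧ ∀ x y : X, ‖f x - f y‖ ≤ L * (‖x - y‖ + 1) := by
  obtain ⟨C, hC⟩ := hf 1 zero_le_one
  have hC0 : 0 ≤ C := by simpa using hC 0 0 (by simp)
  have key : ∀ n : ℕ, ∀ x y : X, ‖x - y‖ ≤ n → ‖f x - f y‖ ≤ n * C := by
    intro n
    induction n with
    | zero =>
      intro x y h
      have : x = y := by simpa [sub_eq_zero] using h
      simp [this]
    | succ n ih =>
      intro x y h
      push_cast at h ⊢
      have hn : (0 : ℝ) < n + 1 := by positivity
      set w : X := y + ((n : ℝ) / (n + 1)) • (x - y) with hw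
      have h1 : ‖w - y‖ ≤ n := by
        rw [hw, add_sub_cancel_left, norm_smul, Real.norm_of_nonneg (by positivity),
          div_mul_eq_mul_div, div_le_iff₀ hn]
        gcongr
      have h2 : ‖x - w‖ ≤ 1 := by
        have : x - w = (1 / ((n : ℝ) + 1)) • (x - y) := by
          have h3 : (1 / ((n : ℝ) + 1)) = 1 - (n : ℝ) / (n + 1) := by field_simp; ring
          rw [hw, h3, sub_smul, one_smul]
          abel
        rw [this, norm_smul, Real.norm_of_nonneg (by positivity), div_mul_eq_mul_div, one_mul,
          div_le_one hn]
        exact h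
      calc ‖f x - f y‖ ≤ ‖f x - f w‖ + ‖f w - f y‖ := norm_sub_le_norm_sub_add_norm_sub _ _ _
        _ ≤ C + n * C := add_le_add (hC _ _ h2) (ih _ _ h1)
        _ = (n + 1) * C := by ring
  refine ⟨C + 1, by positivity, fun x y => (key ⌈‖x - y‖⌉₊ x y (Nat.le_ceil _)).trans ?_⟩
  have := (Nat.ceil_lt_add_one (norm_nonneg (x - y))).le
  calc (⌈‖x - y‖⌉₊ : ℝ) * C ≤ (‖x - y‖ + 1) * (C + 1) := by gcongr; linarith
    _ = _ := mul_comm _ _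

/-- A weakly null sequence is norm close to any closed subspace of finite codimension. -/
lemma eventually_exists_mem_norm_sub_lt {Y : Type*} [NormedAddCommGroup Y] [NormedSpace ℝ Y]
    {E : Submodule ℝ Y} (hE : IsClosed (E : Set Y)) [FiniteDimensional ℝ (Y ⧸ E)]
    {u : ℕ → Y} (hu : ∀ ψ : Y →L[ℝ] ℝ, Tendsto (fun n => ψ (u n)) atTop (nhds 0))
    {η : ℝ} (hη : 0 < η) : ∀ᶠ n in atTop, ∃ y ∈ E, ‖u n - y‖ < η := by
  have : IsClosed (E : Set Y) := hE
  let q : Y →L[ℝ] (Y ⧸ E) := E.mkQL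
  let g : (Y ⧸ E) ≃L[ℝ] (Fin (Module.finrank ℝ (Y ⧸ E)) → ℝ) :=
    ContinuousLinearEquiv.ofFinrankEq (by simp)
  have h1 : Tendsto (fun n => g (q (u n))) atTop (nhds 0) := by
    rw [tendsto_pi_nhds]
    intro i
    exact hu ((ContinuousLinearMap.proj (R := ℝ) (φ := fun _ => ℝ) i).comp
      (g.toContinuousLinearMap.comp q))
  have h2 : Tendsto (fun n => q (u n)) atTop (nhds 0) := by
    have := (g.symm.continuous.tendsto 0).comp h1
    simpa [Function.comp_def] using this
  have h3 := h2.norm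
  rw [norm_zero] at h3
  filter_upwards [h3.eventually (gt_mem_nhds hη)] with n hn
  obtain ⟨m, hm, hmn⟩ := Submodule.Quotient.norm_mk_lt (q (u n)) (sub_pos.2 hn)
  rw [add_sub_cancel] at hmn
  refine ⟨u n - m, ?_, by simpa using hmn⟩
  rw [← Submodule.Quotient.eq]
  exact hm.symm

/-- The norm is weakly sequentially lower semicontinuous. -/
lemma eventually_norm_sub_le_norm_add {X : Type*} [NormedAddCommGroup X] [NormedSpace ℝ X]
    {x : ℕ → X} (hx : ∀ φ : X →L[ℝ] ℝ, Tendsto (fun n => φ (x n)) atTop (nhds 0))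
    (z : X) {η : ℝ} (hη : 0 < η) : ∀ᶠ n in atTop, ‖z‖ - η ≤ ‖z + x n‖ := by
  obtain ⟨φ, hφ, hz⟩ := exists_dual_vector'' ℝ z
  filter_upwards [(hx φ).eventually (lt_mem_nhds (neg_lt_zero.2 hη))] with n hn
  have h1 : φ (z + x n) ≤ ‖z + x n‖ :=
    (le_abs_self _).trans (φ.le_of_opNorm_le_of_le hφ le_rfl |>.trans_eq (one_mul _))
  rw [map_add, hz] at h1
  simp only [RCLike.ofReal_real_eq_id, id_eq] at h1
  linarith

lemma exists_subspace_of_lt_AUCmod {Y : Type*} [NormedAddCommGroup Y] [NormedSpace ℝ Y]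
    {t D : ℝ} (hD : D < AUCmod Y t) {x : Y} (hx : ‖x‖ = 1) :
    ∃ E : Submodule ℝ Y, IsClosed (E : Set Y) ∧ FiniteDimensional ℝ (Y ⧸ E) ∧
      ∀ y ∈ E, ‖y‖ = 1 → D ≤ ‖x + t • y‖ - 1 := by
  have hbelow : ∀ (z : Y) (E : Submodule ℝ Y),
      -1 ∈ lowerBounds { u : ℝ | ∃ y : Y, y ∈ E ∧ ‖y‖ = 1 ∧ u = ‖z + t • y‖ - 1 } := by
    rintro z E _ ⟨y, -, -, rfl⟩
    linarith [norm_nonneg (z + t • y)]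
  have hinf : ∀ (z : Y) (E : Submodule ℝ Y),
      -1 ≤ sInf { u : ℝ | ∃ y : Y, y ∈ E ∧ ‖y‖ = 1 ∧ u = ‖z + t • y‖ - 1 } := by
    intro z E
    rcases Set.eq_empty_or_nonempty
      { u : ℝ | ∃ y : Y, y ∈ E ∧ ‖y‖ = 1 ∧ u = ‖z + t • y‖ - 1 } with h | h
    · rw [h, Real.sInf_empty]; norm_num
    · exact le_csInf h fun u hu => hbelow z E hu
  have hne : ∀ z : Y, (sInf { u : ℝ | ∃ y : Y, y ∈ (⊤ : Submodule ℝ Y) ∧ ‖y‖ = 1 ∧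
      u = ‖z + t • y‖ - 1 }) ∈ { s : ℝ | ∃ E : Subspace ℝ Y, IsClosed (E : Set Y) ∧
      FiniteDimensional ℝ (Y ⧸ E) ∧
      s = sInf { u : ℝ | ∃ y : Y, y ∈ E ∧ ‖y‖ = 1 ∧ u = ‖z + t • y‖ - 1 } } :=
    fun z => ⟨⊤, by simp, inferInstance, rfl⟩
  have hlt : D < sSup { s : ℝ | ∃ E : Subspace ℝ Y, IsClosed (E : Set Y) ∧
      FiniteDimensional ℝ (Y ⧸ E) ∧
      s = sInf { u : ℝ | ∃ y : Y, y ∈ E ∧ ‖y‖ = 1 ∧ u = ‖x + t • y‖ - 1 } } := by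
    refine hD.trans_le (csInf_le ⟨-1, ?_⟩ ⟨x, hx, rfl⟩)
    rintro _ ⟨z, -, rfl⟩
    by_cases hb : BddAbove { s : ℝ | ∃ E : Subspace ℝ Y, IsClosed (E : Set Y) ∧
      FiniteDimensional ℝ (Y ⧸ E) ∧
      s = sInf { u : ℝ | ∃ y : Y, y ∈ E ∧ ‖y‖ = 1 ∧ u = ‖z + t • y‖ - 1 } }
    · exact (hinf z ⊤).trans (le_csSup hb (hne z))
    · rw [Real.sSup_of_not_bddAbove hb]; norm_num
  obtain ⟨_, ⟨E, hE, hfin, rfl⟩, hs⟩ := exists_lt_of_lt_csSup ⟨_, hne x⟩ hlt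
  exact ⟨E, hE, hfin, fun y hy hy1 => hs.le.trans (csInf_le ⟨-1, hbelow x E⟩ ⟨y, hy, hy1, rfl⟩)⟩

/-- Convexity of the norm propagates a lower bound from scale `t` to larger scales. -/
lemma norm_add_ge_of_unit_bound {Y : Type*} [NormedAddCommGroup Y] [NormedSpace ℝ Y]
    {t l D : ℝ} (ht : 0 < t) (hl : 0 < l) (hD0 : 0 ≤ D) {x y : Y} {r : ℝ} (hx : ‖x‖ = 1)
    (hrl : r ≤ l) (hy : t * l ≤ ‖y‖)
    (h : D ≤ ‖x + t • (‖y‖⁻¹ • y)‖ - 1) : r + l * D ≤ ‖r • x + y‖ := by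
  have hm : 0 < ‖y‖ := (mul_pos ht hl).trans_le hy
  set m := ‖y‖
  have hp1 : t * r / m ≤ 1 := by
    rw [div_le_one hm]
    exact (mul_le_mul_of_nonneg_left hrl ht.le).trans hy
  have hdec : x + t • (m⁻¹ • y) = (1 - t * r / m) • x + (t / m) • (r • x + y) := by
    rw [smul_add, smul_smul, smul_smul, sub_smul, one_smul]
    have h1 : t / m * r = t * r / m := by ring
    have h2 : t * m⁻¹ = t / m := by ring
    rw [h1, h2]
    abel
  have hn : ‖x + t • (m⁻¹ • y)‖ ≤ (1 - t * r / m) + t / m * ‖r • x + y‖ := by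
    rw [hdec]
    refine (norm_add_le _ _).trans_eq ?_
    rw [norm_smul, norm_smul, hx, Real.norm_of_nonneg (sub_nonneg.2 hp1),
      Real.norm_of_nonneg (by positivity), mul_one]
  have h2 : D + t * r / m ≤ t / m * ‖r • x + y‖ := by linarith
  have h3 : D * m + t * r ≤ t * ‖r • x + y‖ := by
    have := mul_le_mul_of_nonneg_right h2 hm.le
    field_simp at this
    linarith
  have h4 : t * (r + l * D) ≤ t * ‖r • x + y‖ := by
    nlinarith [mul_le_mul_of_nonneg_left hy hD0]
  exact le_of_mul_le_mul_left h4 ht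

lemma eventually_add_le_norm_add_of_lt_AUCmod {Y : Type*} [NormedAddCommGroup Y]
    [NormedSpace ℝ Y] {t l D b η : ℝ} (ht : 0 < t) (hl : 0 < l) (htl : t * l < b) (hD0 : 0 ≤ D)
    (hD : D < AUCmod Y t) {u : ℕ → Y} (hub : ∀ n, b ≤ ‖u n‖)
    (hu : ∀ ψ : Y →L[ℝ] ℝ, Tendsto (fun n => ψ (u n)) atTop (nhds 0))
    {v : Y} (hv : ‖v‖ ≤ l) (hη : 0 < η) :
    ∀ᶠ n in atTop, ‖v‖ + l * D - η ≤ ‖v + u n‖ := by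
  have hε : 0 < min η (b - t * l) := lt_min hη (sub_pos.2 htl)
  have hpos : ∀ {n : ℕ} {y : Y}, ‖u n - y‖ < min η (b - t * l) → t * l ≤ ‖y‖ := by
    intro n y hy
    have h1 := norm_sub_norm_le (u n) y
    have h2 := hub n
    have h3 := hy.trans_le (min_le_right _ _)
    linarith
  have hunit : ∀ {y : Y}, t * l ≤ ‖y‖ → ‖‖y‖⁻¹ • y‖ = 1 := by
    intro y hy
    have : 0 < ‖y‖ := (mul_pos ht hl).trans_le hy
    rw [norm_smul, norm_inv, norm_norm, inv_mul_cancel₀ this.ne']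
  rcases eq_or_ne v 0 with rfl | hv0
  · obtain ⟨E, hE, hfin, hED⟩ :=
      exists_subspace_of_lt_AUCmod hD (hunit (htl.le.trans (hub 0)))
    filter_upwards [eventually_exists_mem_norm_sub_lt hE hu hε] with n ⟨y, hyE, hy⟩
    have hy1 := hunit (hpos hy)
    have h1 := hED _ (E.smul_mem ‖y‖⁻¹ hyE) hy1
    have h2 := norm_add_le (‖u 0‖⁻¹ • u 0) (t • (‖y‖⁻¹ • y))
    rw [hunit (htl.le.trans (hub 0)), norm_smul t, hy1, Real.norm_of_nonneg ht.le] at h2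
    have h3 : D * l ≤ t * l := mul_le_mul_of_nonneg_right (by linarith) hl.le
    have h4 := hub n
    rw [norm_zero, zero_add, zero_add]
    linarith
  · have hv0' : 0 < ‖v‖ := norm_pos_iff.2 hv0
    have hx : ‖‖v‖⁻¹ • v‖ = 1 := by
      rw [norm_smul, norm_inv, norm_norm, inv_mul_cancel₀ hv0'.ne']
    obtain ⟨E, hE, hfin, hED⟩ := exists_subspace_of_lt_AUCmod hD hx
    filter_upwards [eventually_exists_mem_norm_sub_lt hE hu hε] with n ⟨y, hyE, hy⟩
    have h1 := norm_add_ge_of_unit_bound ht hl hD0 hx hv (hpos hy)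
      (hED _ (E.smul_mem ‖y‖⁻¹ hyE) (hunit (hpos hy)))
    rw [smul_smul, mul_inv_cancel₀ hv0'.ne', one_smul] at h1
    have h2 := norm_sub_norm_le (v + y) (v + u n)
    rw [add_sub_add_left_eq_sub, norm_sub_rev] at h2
    have h3 := hy.trans_le (min_le_left _ _)
    linarith

lemma exists_strictMono_of_eventually {X : Type*} [AddCommMonoid X] (x : ℕ → X)
    {P : X → ℕ → Prop} (hP : ∀ z, ∀ᶠ n in atTop, P z n) (ℓ : ℕ) :
    ∃ n : ℕ → ℕ, StrictMono n ∧ (∀ i, ℓ ≤ n i) ∧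
      ∀ j, P (∑ i ∈ Finset.range j, x (n i)) (n j) := by
  choose N hN using fun z => eventually_atTop.1 (hP z)
  let pick : ℕ × X → ℕ := fun p => max p.1 (N p.2)
  let s : ℕ → ℕ × X := fun j =>
    Nat.rec (ℓ, 0) (fun _ p => (pick p + 1, p.2 + x (pick p))) j
  have hs : ∀ j, s (j + 1) = (pick (s j) + 1, (s j).2 + x (pick (s j))) := fun j => rfl
  have hmono : StrictMono fun j => pick (s j) := by
    refine strictMono_nat_of_lt_succ fun j => ?_
    have : (s (j + 1)).1 = pick (s j) + 1 := by rw [hs]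
    exact (Nat.lt_succ_self _).trans_le (this.ge.trans (le_max_left _ _))
  have hsum : ∀ j, (s j).2 = ∑ i ∈ Finset.range j, x (pick (s i)) := by
    intro j
    induction j with
    | zero => rfl
    | succ j ih => rw [Finset.sum_range_succ, ← ih, hs]
  refine ⟨fun j => pick (s j), hmono, fun i => ?_, fun j => ?_⟩
  · exact (le_max_left ℓ _).trans (hmono.monotone (Nat.zero_le i))
  · rw [← hsum]
    exact hN _ _ (le_max_right _ _)

lemma sub_mul_le_of_sub_le_succ {a : ℕ → ℝ} {η : ℝ} (h : ∀ j, a j - η ≤ a (j + 1)) (i m : ℕ) :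
    a i - m * η ≤ a (i + m) := by
  induction m with
  | zero => simp
  | succ m ih =>
    have := h (i + m)
    rw [← add_assoc]
    push_cast
    linarith

lemma IsSpreadingModel.exists_norm_sum_range_close {X S : Type*} [NormedAddCommGroup X]
    [NormedSpace ℝ X] [NormedAddCommGroup S] [NormedSpace ℝ S] {x : ℕ → X} {e : ℕ → S}
    (h : IsSpreadingModel x e) (k : ℕ) {ε : ℝ} (hε : 0 < ε) :
    ∃ ℓ : ℕ, ∀ n : ℕ → ℕ, StrictMono n → (∀ i, ℓ ≤ n i) →
      |‖∑ i ∈ Finset.range k, x (n i)‖ - ‖∑ i : Fin k, e (i : ℕ)‖| ≤ ε := by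
  obtain ⟨ℓ, hℓ⟩ := h ε hε k
  refine ⟨ℓ, fun n hn hn' => ?_⟩
  have := hℓ (fun i => n i) (fun i j hij => hn hij) (fun i => hn' i) (fun _ => 1) (by simp)
  simpa [Finset.sum_range] using this

lemma IsSpreadingModel.half_le_norm_sum {X S : Type*} [NormedAddCommGroup X]
    [NormedSpace ℝ X] [NormedAddCommGroup S] [NormedSpace ℝ S] {x : ℕ → X} {e : ℕ → S}
    (h : IsSpreadingModel x e) (hx1 : ∀ n, ‖x n‖ = 1)
    (hx : ∀ φ : X →L[ℝ] ℝ, Tendsto (fun n => φ (x n)) atTop (nhds 0)) {k : ℕ} (hk : 0 < k) :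
    1 / 2 ≤ ‖∑ i : Fin k, e (i : ℕ)‖ := by
  have hk' : (0 : ℝ) < k := Nat.cast_pos.2 hk
  obtain ⟨ℓ, hℓ⟩ := h.exists_norm_sum_range_close k (ε := 1 / 4) (by norm_num)
  obtain ⟨n, hn, hnℓ, hP⟩ := exists_strictMono_of_eventually x
    (fun z => eventually_norm_sub_le_norm_add hx z (η := 1 / (4 * k)) (by positivity)) ℓ
  have h1 := sub_mul_le_of_sub_le_succ (a := fun j => ‖∑ i ∈ Finset.range j, x (n i)‖)
    (fun j => by simpa only [Finset.sum_range_succ] using hP j) 1 (k - 1)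
  rw [Nat.add_sub_cancel' hk] at h1
  simp only [Finset.sum_range_one, hx1] at h1
  have h2 : ((k - 1 : ℕ) : ℝ) * (1 / (4 * k)) ≤ 1 / 4 := by
    have : ((k - 1 : ℕ) : ℝ) ≤ k := by exact_mod_cast Nat.sub_le _ _
    calc ((k - 1 : ℕ) : ℝ) * (1 / (4 * k)) ≤ k * (1 / (4 * k)) := by gcongr
      _ = 1 / 4 := by field_simp
  have h3 := (abs_le.1 (hℓ n hn hnℓ)).2
  linarith

/-- Theorem 1.3 / `MainResult`: if `f : X → Y` is weakly sequentially
continuous, coarse and satisfies Property (*), then there is `c > 0` such that every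
spreading model `(e_n)` of a normalized weakly null sequence in `X` satisfies
`c · ‖e_1 + … + e_k‖_{δ̄_Y} ≤ ‖e_1 + … + e_k‖_S` for all `k`. -/
theorem stmt0 {X Y : Type*} [NormedAddCommGroup X] [NormedSpace ℝ X] [CompleteSpace X]
    [NormedAddCommGroup Y] [NormedSpace ℝ Y] [CompleteSpace Y]
    (f : X → Y) (hwsc : WeakSeqCont f) (hcoarse : Coarse f) (hstar : PropertyStar f) :
    ∃ c : ℝ, 0 < c ∧
      ∀ x : ℕ → X, (∀ n, ‖x n‖ = 1) →
        (∀ φ : X →L[ℝ] ℝ, Tendsto (fun n => φ (x n)) atTop (nhds 0)) →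
        ∀ (S : Type*) [NormedAddCommGroup S] [NormedSpace ℝ S] [CompleteSpace S]
          (e : ℕ → S), IsSpreadingModel x e →
          ∀ k : ℕ,
            c * sInf { l : ℝ | 0 < l ∧ (k : ℝ) * AUCmod Y (1 / l) ≤ 1 }
              ≤ ‖∑ i : Fin k, e (i : ℕ)‖ := by
  obtain ⟨L, hL, hLf⟩ := hcoarse.exists_bound
  obtain ⟨α, β, b, hα, hαβ, hb, hstar⟩ := hstar
  refine ⟨b / (2 * L * (5 * α + 2)), by positivity, ?_⟩
  intro x hx1 hx S _ _ _ e he k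
  rcases Nat.eq_zero_or_pos k with rfl | hk
  · have : { l : ℝ | 0 < l ∧ ((0 : ℕ) : ℝ) * AUCmod Y (1 / l) ≤ 1 } = Set.Ioi 0 := by
      ext l; simp
    rw [this, csInf_Ioi]
    simp
  have hk' : (0 : ℝ) < k := Nat.cast_pos.2 hk
  have hM := he.half_le_norm_sum hx1 hx hk
  set M := ‖∑ i : Fin k, e (i : ℕ)‖ with hMdef
  set l : ℝ := L * (α * (M + 2) + 1) with hldef
  have hl : 0 < l := by positivity
  have hlM : l ≤ L * (5 * α + 2) * M := by
    have h1 : α * (M + 2) + 1 ≤ (5 * α + 2) * M := by nlinarith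
    calc l ≤ L * ((5 * α + 2) * M) := mul_le_mul_of_nonneg_left h1 hL.le
      _ = _ := by ring
  suffices hmem : (k : ℝ) * AUCmod Y (1 / (2 * l / b)) ≤ 1 by
    have h1 : sInf { l : ℝ | 0 < l ∧ (k : ℝ) * AUCmod Y (1 / l) ≤ 1 } ≤ 2 * l / b :=
      csInf_le ⟨0, fun r hr => hr.1.le⟩ ⟨by positivity, hmem⟩
    calc b / (2 * L * (5 * α + 2)) * sInf { l : ℝ | 0 < l ∧ (k : ℝ) * AUCmod Y (1 / l) ≤ 1 }
        ≤ b / (2 * L * (5 * α + 2)) * (2 * (L * (5 * α + 2) * M) / b) := by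
          gcongr
          exact h1.trans (by gcongr)
      _ = M := by field_simp
  by_contra! hcon
  set t : ℝ := 1 / (2 * l / b) with ht
  have ht0 : 0 < t := by positivity
  have htl : t * l < b := by
    have : t * l = b / 2 := by rw [ht]; field_simp
    linarith
  obtain ⟨D, hD1, hD⟩ : ∃ D, 1 / (k : ℝ) < D ∧ D < AUCmod Y t :=
    exists_between (by rwa [div_lt_iff₀' hk'])
  have hkD : 1 < k * D := by rwa [div_lt_iff₀' hk'] at hD1
  have hD0 : 0 ≤ D := (by positivity : (0 : ℝ) ≤ 1 / k).trans hD1.le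
  set η : ℝ := min (1 / k) (l * (k * D - 1) / (2 * k)) with hηdef
  have hη : 0 < η := by
    have : 0 < k * D - 1 := by linarith
    positivity
  have hkη1 : k * η ≤ 1 :=
    (mul_le_mul_of_nonneg_left (min_le_left _ _) hk'.le).trans_eq (by field_simp)
  have hkη2 : k * η ≤ l * (k * D - 1) / 2 :=
    (mul_le_mul_of_nonneg_left (min_le_right _ _) hk'.le).trans_eq (by field_simp)
  have hstep : ∀ z : X, ∀ᶠ n in atTop, ‖z‖ - η ≤ ‖z + x n‖ ∧
      (‖f (α • z) - f 0‖ ≤ l →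
        ‖f (α • z) - f 0‖ + l * D - η ≤ ‖f (α • (z + x n)) - f 0‖) := by
    intro z
    refine (eventually_norm_sub_le_norm_add hx z hη).and ?_
    by_cases hz : ‖f (α • z) - f 0‖ ≤ l
    · have hub : ∀ n, b ≤ ‖f (α • (z + x n)) - f (α • z)‖ := by
        intro n
        have : ‖α • (z + x n) - α • z‖ = α := by
          rw [← smul_sub, add_sub_cancel_left, norm_smul, hx1, mul_one, Real.norm_of_nonneg hα.le]
        exact hstar _ _ this.ge (this.trans_le hαβ.le)
      have hu : ∀ ψ : Y →L[ℝ] ℝ,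
          Tendsto (fun n => ψ (f (α • (z + x n)) - f (α • z))) atTop (nhds 0) := by
        intro ψ
        have h1 := hwsc (fun n => α • (z + x n)) (α • z) (fun φ => by
          have := ((hx φ).const_add (φ z)).const_mul α
          simpa [mul_add] using this) ψ
        have := h1.sub_const (ψ (f (α • z)))
        simpa using this
      filter_upwards [eventually_add_le_norm_add_of_lt_AUCmod ht0 hl htl hD0 hD hub hu hz hη]
        with n hn _
      have h2 : f (α • z) - f 0 + (f (α • (z + x n)) - f (α • z)) = f (α • (z + x n)) - f 0 := by
        abel
      rwa [h2] at hn
    · exact Eventually.of_forall fun n h => absurd h hz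
  obtain ⟨ℓ, hℓ⟩ := he.exists_norm_sum_range_close k one_pos
  obtain ⟨n, hn, hnℓ, hP⟩ := exists_strictMono_of_eventually x hstep ℓ
  simp only [← Finset.sum_range_succ (fun i => x (n i))] at hP
  set z : ℕ → X := fun j => ∑ i ∈ Finset.range j, x (n i) with hz
  have hzk : ‖z k‖ ≤ M + 1 := by
    have := (abs_le.1 (hℓ n hn hnℓ)).2
    simp only [hz]
    linarith
  have hzj : ∀ j ≤ k, ‖z j‖ ≤ M + 2 := by
    intro j hj
    have h1 := sub_mul_le_of_sub_le_succ (a := fun j => ‖z j‖) (fun j => (hP j).1) j (k - j)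
    rw [Nat.add_sub_cancel' hj] at h1
    have h2 : ((k - j : ℕ) : ℝ) * η ≤ k * η := by
      gcongr
      exact Nat.sub_le _ _
    linarith
  have hvj : ∀ j ≤ k, ‖f (α • z j) - f 0‖ ≤ l := by
    intro j hj
    refine (hLf _ _).trans ?_
    rw [sub_zero, norm_smul, Real.norm_of_nonneg hα.le, hldef]
    have := hzj j hj
    gcongr
  have hgrow : ∀ j ≤ k, j * (l * D - η) ≤ ‖f (α • z j) - f 0‖ := by
    intro j
    induction j with
    | zero => intro _; simp
    | succ j ih =>
      intro hj
      have h1 := ih (by omega)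
      have h2 := (hP j).2 (hvj j (by omega))
      push_cast
      simp only [hz] at h1 h2 ⊢
      linarith
  have h1 := (hgrow k le_rfl).trans (hvj k le_rfl)
  have h2 : 0 < l * (k * D - 1) := mul_pos hl (by linarith)
  linarith
end

section
/- Let p ∈ (1, 2) and let X be a closed linear subspace of the real Lebesgue space L_p(0,1) (real-valued p-integrable functions on the unit interval with Lebesgue measure). Suppose there exists a map f : X → ℓ_p which is weakly sequentially continuous, coarse, and satisfies Property (*). Then X is linearly isomorphic to a closed subspace of ℓ_p: there exist a bounded linear operator T : X → ℓ_p and constants 0 < c ≤ C such that c·‖x‖ ≤ ‖T x‖ ≤ C·‖x‖ for all x ∈ X. -/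
open Filter

open MeasureTheory

section DyadicAverages

/-- Lebesgue measure on the unit interval. -/
noncomputable abbrev unitVolume : Measure ℝ := volume.restrict (Set.Ioo (0 : ℝ) 1)

/-- The space `L_p(0,1)`. -/
noncomputable abbrev UnitLp (p : ℝ) := Lp ℝ (ENNReal.ofReal p) unitVolume

instance isProbabilityMeasure_unitVolume : IsProbabilityMeasure unitVolume :=
  ⟨by simp [unitVolume]⟩

/-- The index of the dyadic interval of generation `n` that contains `t`. -/
noncomputable def dyadicIndex (n : ℕ) (t : ℝ) : ℕ := ⌊(2 : ℝ) ^ n * t⌋₊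

/-- The dyadic interval of generation `n` with index `i`. -/
def dyadicCell (n i : ℕ) : Set ℝ := dyadicIndex n ⁻¹' {i}

lemma measurable_dyadicIndex (n : ℕ) : Measurable (dyadicIndex n) :=
  Nat.measurable_floor.comp (measurable_const.mul measurable_id)

lemma measurableSet_dyadicCell (n i : ℕ) : MeasurableSet (dyadicCell n i) :=
  measurable_dyadicIndex n (measurableSet_singleton i)

lemma dyadicIndex_lt {n : ℕ} {t : ℝ} (ht : t ∈ Set.Ioo (0 : ℝ) 1) : dyadicIndex n t < 2 ^ n := by
  rw [dyadicIndex, Nat.floor_lt (by have := ht.1; positivity)]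
  push_cast
  have : (0 : ℝ) < 2 ^ n := by positivity
  nlinarith [ht.2]

lemma dyadicIndex_div {m n : ℕ} (h : m ≤ n) (t : ℝ) :
    dyadicIndex m t = dyadicIndex n t / 2 ^ (n - m) := by
  rw [dyadicIndex, dyadicIndex, ← Nat.floor_div_natCast]
  congr 1
  obtain ⟨k, rfl⟩ := Nat.exists_eq_add_of_le h
  push_cast
  rw [Nat.add_sub_cancel_left, pow_add]
  field_simp

lemma ae_dyadicIndex_lt (n : ℕ) : ∀ᵐ t ∂unitVolume, dyadicIndex n t < 2 ^ n := by
  filter_upwards [ae_restrict_mem measurableSet_Ioo] with t ht using dyadicIndex_lt ht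

/-- The σ-algebra generated by the dyadic intervals of generation `n`. -/
@[reducible]
noncomputable def dyadicSigma (n : ℕ) : MeasurableSpace ℝ := MeasurableSpace.comap (dyadicIndex n) ⊤

lemma dyadicSigma_le (n : ℕ) : dyadicSigma n ≤ (inferInstance : MeasurableSpace ℝ) :=
  (measurable_dyadicIndex n).comap_le

lemma dyadicSigma_mono : Monotone dyadicSigma := by
  intro m n h
  rintro s ⟨T, -, rfl⟩
  refine ⟨(fun i => i / 2 ^ (n - m)) ⁻¹' T, trivial, ?_⟩
  ext t
  simp [dyadicIndex_div h]

lemma setIntegral_dyadicIndex_preimage (n : ℕ) (T : Set ℕ) [DecidablePred (· ∈ T)] {g : ℝ → ℝ}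
    (hg : Integrable g unitVolume) :
    ∫ t in dyadicIndex n ⁻¹' T, g t ∂unitVolume
      = ∑ i ∈ (Finset.range (2 ^ n)).filter (· ∈ T), ∫ t in dyadicCell n i, g t ∂unitVolume := by
  rw [← integral_biUnion_finset]
  · refine setIntegral_congr_set ?_
    filter_upwards [ae_dyadicIndex_lt n] with t ht
    refine propext ?_
    change dyadicIndex n t ∈ T ↔ t ∈ ⋃ i ∈ (Finset.range (2 ^ n)).filter (· ∈ T), dyadicCell n i
    simp [dyadicCell, ht]
  · exact fun i _ => measurableSet_dyadicCell n i
  · intro i _ j _ hij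
    exact Disjoint.preimage _ (by simpa using hij)
  · exact fun i _ => hg.integrableOn

lemma integral_eq_sum_dyadicCell (n : ℕ) {g : ℝ → ℝ} (hg : Integrable g unitVolume) :
    ∫ t, g t ∂unitVolume
      = ∑ i ∈ Finset.range (2 ^ n), ∫ t in dyadicCell n i, g t ∂unitVolume := by
  classical
  have := setIntegral_dyadicIndex_preimage n Set.univ hg
  simpa using this

/-- The average of `g` over the dyadic intervals of generation `n`. -/
noncomputable def dyadicAvg (n : ℕ) (g : ℝ → ℝ) (t : ℝ) : ℝ :=
  (unitVolume.real (dyadicCell n (dyadicIndex n t)))⁻¹ *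
    ∫ s in dyadicCell n (dyadicIndex n t), g s ∂unitVolume

lemma exists_forall_abs_comp_dyadicIndex_le (n : ℕ) (G : ℕ → ℝ) :
    ∃ M, 0 ≤ M ∧ ∀ᵐ t ∂unitVolume, |G (dyadicIndex n t)| ≤ M := by
  refine ⟨∑ i ∈ Finset.range (2 ^ n), |G i|, by positivity, ?_⟩
  filter_upwards [ae_dyadicIndex_lt n] with t ht
  exact Finset.single_le_sum (f := fun i => |G i|) (fun i _ => abs_nonneg _) (by simpa using ht)

lemma measurable_comp_dyadicIndex (n : ℕ) (G : ℕ → ℝ) :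
    Measurable fun t => G (dyadicIndex n t) :=
  (measurable_of_countable G).comp (measurable_dyadicIndex n)

lemma integrable_comp_dyadicIndex (n : ℕ) (G : ℕ → ℝ) :
    Integrable (fun t => G (dyadicIndex n t)) unitVolume := by
  obtain ⟨M, -, hM⟩ := exists_forall_abs_comp_dyadicIndex_le n G
  exact Integrable.of_bound (measurable_comp_dyadicIndex n G).aestronglyMeasurable M hM

lemma setIntegral_dyadicCell_comp (n i : ℕ) (G : ℕ → ℝ) :
    ∫ t in dyadicCell n i, G (dyadicIndex n t) ∂unitVolume
      = unitVolume.real (dyadicCell n i) * G i := by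
  rw [setIntegral_congr_fun (g := fun _ => G i) (measurableSet_dyadicCell n i)]
  · simp
  · intro t ht
    change G (dyadicIndex n t) = G i
    rw [show dyadicIndex n t = i from ht]

lemma dyadicAvg_ae_eq_condExp (n : ℕ) {g : ℝ → ℝ} (hg : Integrable g unitVolume) :
    dyadicAvg n g =ᵐ[unitVolume] unitVolume[g | dyadicSigma n] := by
  classical
  set G : ℕ → ℝ := fun i => (unitVolume.real (dyadicCell n i))⁻¹ *
    ∫ s in dyadicCell n i, g s ∂unitVolume with hG
  have hint : Integrable (dyadicAvg n g) unitVolume := integrable_comp_dyadicIndex n G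
  refine ae_eq_condExp_of_forall_setIntegral_eq (dyadicSigma_le n) hg
    (fun s _ _ => hint.integrableOn) ?_ ?_
  · rintro s ⟨T, -, rfl⟩ -
    rw [setIntegral_dyadicIndex_preimage n T hg, setIntegral_dyadicIndex_preimage n T hint]
    refine Finset.sum_congr rfl fun i _ => ?_
    refine (setIntegral_dyadicCell_comp n i G).trans ?_
    by_cases h : unitVolume.real (dyadicCell n i) = 0
    · have h' : unitVolume (dyadicCell n i) = 0 := by
        rwa [measureReal_eq_zero_iff] at h
      rw [h, Measure.restrict_eq_zero.2 h']
      simp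
    · rw [hG, mul_inv_cancel_left₀ h]
  · have h1 : Measurable[dyadicSigma n] (dyadicIndex n) := fun s _ => ⟨s, trivial, rfl⟩
    have h2 : Measurable[dyadicSigma n] (dyadicAvg n g) := (measurable_of_countable G).comp h1
    exact h2.stronglyMeasurable.aestronglyMeasurable

end DyadicAverages

section DyadicProjections

variable {p : ℝ}

lemma norm_rpow_eq_integral (hp : 0 < p) (x : UnitLp p) :
    ‖x‖ ^ p = ∫ t, |x t| ^ p ∂unitVolume := by
  have h0 : ENNReal.ofReal p ≠ 0 := by simpa using hp
  have h := (Lp.memLp x).eLpNorm_eq_integral_rpow_norm h0 ENNReal.ofReal_ne_top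
  rw [ENNReal.toReal_ofReal hp.le] at h
  have h1 : 0 ≤ ∫ t, |x t| ^ p ∂unitVolume := integral_nonneg fun t => by positivity
  simp only [Real.norm_eq_abs] at h
  rw [Lp.norm_def, h, ENNReal.toReal_ofReal (by positivity), ← Real.rpow_mul h1,
    inv_mul_cancel₀ hp.ne', Real.rpow_one]

lemma integrable_abs_rpow (hp : 0 < p) (x : UnitLp p) :
    Integrable (fun t => |x t| ^ p) unitVolume := by
  have h := (Lp.memLp x).integrable_norm_rpow (by simpa using hp) ENNReal.ofReal_ne_top
  simpa only [ENNReal.toReal_ofReal hp.le, Real.norm_eq_abs] using h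

lemma coeFn_finset_sum {ι : Type*} (s : Finset ι) (f : ι → UnitLp p) :
    ⇑(∑ i ∈ s, f i) =ᵐ[unitVolume] fun t => ∑ i ∈ s, f i t := by
  classical
  induction s using Finset.induction_on with
  | empty =>
    simp only [Finset.sum_empty]
    exact Lp.coeFn_zero ℝ (ENNReal.ofReal p) unitVolume
  | insert a s ha ih =>
    rw [Finset.sum_insert ha]
    filter_upwards [ih, Lp.coeFn_add (f a) (∑ i ∈ s, f i)] with t h1 h2
    rw [h2, Finset.sum_insert ha, Pi.add_apply, h1]

variable [hp1 : Fact (1 ≤ ENNReal.ofReal p)]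

lemma integrable_unitLp (x : UnitLp p) : Integrable x unitVolume :=
  (Lp.memLp x).integrable hp1.out

/-- The integral over a dyadic interval as a functional on `L_p(0,1)`. -/
noncomputable def cellIntegral (p : ℝ) [hp1 : Fact (1 ≤ ENNReal.ofReal p)] (n i : ℕ) :
    UnitLp p →L[ℝ] ℝ :=
  LinearMap.mkContinuous
    { toFun := fun x => ∫ t in dyadicCell n i, x t ∂unitVolume
      map_add' := fun x y => by
        rw [← integral_add (integrable_unitLp x).integrableOn (integrable_unitLp y).integrableOn]
        exact integral_congr_ae (ae_restrict_of_ae (Lp.coeFn_add x y))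
      map_smul' := fun c x => by
        rw [RingHom.id_apply, ← integral_smul]
        exact integral_congr_ae (ae_restrict_of_ae (Lp.coeFn_smul c x)) } 1 (fun x => by
    have h1 : ‖∫ t in dyadicCell n i, x t ∂unitVolume‖ ≤ ∫ t, ‖x t‖ ∂unitVolume :=
      (norm_integral_le_integral_norm _).trans
        (setIntegral_le_integral (integrable_unitLp x).norm (ae_of_all _ fun t => norm_nonneg _))
    refine h1.trans ?_
    rw [one_mul, Lp.norm_def, integral_norm_eq_lintegral_enorm (Lp.aestronglyMeasurable x),
      ← eLpNorm_one_eq_lintegral_enorm]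
    exact ENNReal.toReal_mono (Lp.eLpNorm_ne_top x)
      (eLpNorm_le_eLpNorm_of_exponent_le hp1.out (Lp.aestronglyMeasurable x)))

lemma cellIntegral_apply (n i : ℕ) (x : UnitLp p) :
    cellIntegral p n i x = ∫ t in dyadicCell n i, x t ∂unitVolume := rfl

/-- The conditional expectation onto step functions on dyadic intervals of generation `n`. -/
noncomputable def dyadicProj (p : ℝ) [Fact (1 ≤ ENNReal.ofReal p)] (n : ℕ) :
    UnitLp p →L[ℝ] UnitLp p :=
  ∑ i ∈ Finset.range (2 ^ n), ((unitVolume.real (dyadicCell n i))⁻¹ • cellIntegral p n i).smulRight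
    (indicatorConstLp (ENNReal.ofReal p) (measurableSet_dyadicCell n i) (measure_ne_top _ _) (1 : ℝ))

lemma dyadicProj_apply (n : ℕ) (x : UnitLp p) :
    dyadicProj p n x = ∑ i ∈ Finset.range (2 ^ n),
      ((unitVolume.real (dyadicCell n i))⁻¹ * cellIntegral p n i x) •
        indicatorConstLp (ENNReal.ofReal p) (measurableSet_dyadicCell n i)
          (measure_ne_top _ _) (1 : ℝ) := by
  simp [dyadicProj]

lemma coeFn_dyadicProj (n : ℕ) (x : UnitLp p) :
    ⇑(dyadicProj p n x) =ᵐ[unitVolume] dyadicAvg n x := by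
  rw [dyadicProj_apply]
  have h1 : ∀ᵐ t ∂unitVolume, ∀ i : ℕ,
      (((unitVolume.real (dyadicCell n i))⁻¹ * cellIntegral p n i x) •
        indicatorConstLp (ENNReal.ofReal p) (measurableSet_dyadicCell n i)
          (measure_ne_top unitVolume _) (1 : ℝ) : UnitLp p) t
      = (unitVolume.real (dyadicCell n i))⁻¹ * cellIntegral p n i x *
        (dyadicCell n i).indicator (fun _ => 1) t := by
    rw [ae_all_iff]
    intro i
    filter_upwards [Lp.coeFn_smul ((unitVolume.real (dyadicCell n i))⁻¹ * cellIntegral p n i x)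
      (indicatorConstLp (ENNReal.ofReal p) (measurableSet_dyadicCell n i)
          (measure_ne_top unitVolume _) (1 : ℝ)), indicatorConstLp_coeFn (p := ENNReal.ofReal p)
          (hs := measurableSet_dyadicCell n i) (hμs := measure_ne_top unitVolume _) (c := (1 : ℝ))]
      with t h1 h2
    rw [h1, Pi.smul_apply, h2, smul_eq_mul]
  filter_upwards [coeFn_finset_sum (p := p) (Finset.range (2 ^ n)) _, h1, ae_dyadicIndex_lt n]
    with t h2 h3 h4
  rw [h2, Finset.sum_congr rfl fun i _ => h3 i, Finset.sum_eq_single (dyadicIndex n t)]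
  · simp [dyadicAvg, dyadicCell, cellIntegral_apply]
  · intro i _ hi
    have : t ∉ dyadicCell n i := fun h => hi h.symm
    simp [this]
  · simp [h4]

lemma coeFn_dyadicProj_condExp (n : ℕ) (x : UnitLp p) :
    ⇑(dyadicProj p n x) =ᵐ[unitVolume] unitVolume[x | dyadicSigma n] :=
  (coeFn_dyadicProj n x).trans (dyadicAvg_ae_eq_condExp n (integrable_unitLp x))

lemma norm_dyadicProj_le (n : ℕ) (x : UnitLp p) : ‖dyadicProj p n x‖ ≤ ‖x‖ := by
  rw [Lp.norm_def, Lp.norm_def]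
  refine ENNReal.toReal_mono (Lp.eLpNorm_ne_top x) ?_
  rw [eLpNorm_congr_ae (coeFn_dyadicProj_condExp n x)]
  exact eLpNorm_condExp_le_eLpNorm _ hp1.out

lemma dyadicProj_dyadicProj_of_le {m n : ℕ} (h : m ≤ n) (x : UnitLp p) :
    dyadicProj p m (dyadicProj p n x) = dyadicProj p m x := by
  refine Lp.ext ((coeFn_dyadicProj_condExp m _).trans ?_)
  refine (condExp_congr_ae (coeFn_dyadicProj_condExp n x)).trans ?_
  exact (condExp_condExp_of_le (dyadicSigma_mono h) (dyadicSigma_le n)).trans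
    (coeFn_dyadicProj_condExp m x).symm

lemma dyadicProj_dyadicProj_of_ge {m n : ℕ} (h : n ≤ m) (x : UnitLp p) :
    dyadicProj p m (dyadicProj p n x) = dyadicProj p n x := by
  refine Lp.ext ((coeFn_dyadicProj_condExp m _).trans ?_)
  refine (condExp_congr_ae (coeFn_dyadicProj_condExp n x)).trans ?_
  rw [condExp_of_stronglyMeasurable (dyadicSigma_le m)
    (stronglyMeasurable_condExp.mono (dyadicSigma_mono h)) integrable_condExp]
  exact (coeFn_dyadicProj_condExp n x).symm

lemma norm_dyadicProj_rpow (hp : 0 < p) (n : ℕ) (x : UnitLp p) :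
    ‖dyadicProj p n x‖ ^ p = ∑ i ∈ Finset.range (2 ^ n),
      |unitVolume.real (dyadicCell n i) ^ (p⁻¹ - 1) * cellIntegral p n i x| ^ p := by
  rw [norm_rpow_eq_integral hp, integral_eq_sum_dyadicCell n (integrable_abs_rpow hp _)]
  refine Finset.sum_congr rfl fun i _ => ?_
  set G : ℕ → ℝ := fun j => |(unitVolume.real (dyadicCell n j))⁻¹ * cellIntegral p n j x| ^ p
  have h1 : ∫ t in dyadicCell n i, |dyadicProj p n x t| ^ p ∂unitVolume
      = ∫ t in dyadicCell n i, G (dyadicIndex n t) ∂unitVolume := by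
    refine integral_congr_ae (ae_restrict_of_ae ?_)
    filter_upwards [coeFn_dyadicProj n x] with t ht
    rw [ht]
    rfl
  rw [h1, setIntegral_dyadicCell_comp]
  set a := unitVolume.real (dyadicCell n i) with ha
  have ha0 : 0 ≤ a := measureReal_nonneg
  rcases ha0.eq_or_lt with h | h
  · have h' : cellIntegral p n i x = 0 := by
      have : unitVolume (dyadicCell n i) = 0 := by
        rw [eq_comm, ha, measureReal_eq_zero_iff] at h
        exact h
      rw [cellIntegral_apply, Measure.restrict_eq_zero.2 this]
      simp
    simp [G, h', ← h, Real.zero_rpow hp.ne']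
  · have key : a * a⁻¹ ^ p = (a ^ (p⁻¹ - 1)) ^ p := by
      rw [← Real.rpow_mul h.le, Real.inv_rpow h.le, sub_mul, inv_mul_cancel₀ hp.ne', one_mul,
        Real.rpow_sub h, Real.rpow_one, div_eq_mul_inv]
    simp only [G, abs_mul, ← ha]
    rw [abs_of_nonneg (inv_nonneg.2 ha0), abs_of_nonneg (Real.rpow_nonneg ha0 _),
      Real.mul_rpow (inv_nonneg.2 ha0) (abs_nonneg _),
      Real.mul_rpow (Real.rpow_nonneg ha0 _) (abs_nonneg _), ← mul_assoc, key]

lemma tendsto_dyadicProj_of_tendsto_cellIntegral {ι : Type*} {l : Filter ι} {x : ι → UnitLp p}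
    {c : ℕ → ℝ} {n : ℕ} (h : ∀ i, Tendsto (fun k => cellIntegral p n i (x k)) l (nhds (c i))) :
    ∃ y : UnitLp p, Tendsto (fun k => dyadicProj p n (x k)) l (nhds y) := by
  simp only [dyadicProj_apply]
  exact ⟨_, tendsto_finsetSum _ fun i _ => ((h i).const_mul _).smul_const _⟩

end DyadicProjections

section DyadicConvergence

lemma abs_sub_lt_of_dyadicIndex_eq {n : ℕ} {s t : ℝ} (hs : 0 ≤ s) (ht : 0 ≤ t)
    (h : dyadicIndex n s = dyadicIndex n t) : |s - t| < (1 / 2) ^ n := by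
  have h2 : (0 : ℝ) < 2 ^ n := by positivity
  have hs1 := Nat.floor_le (show 0 ≤ (2 : ℝ) ^ n * s by positivity)
  have ht1 := Nat.floor_le (show 0 ≤ (2 : ℝ) ^ n * t by positivity)
  have hs2 := Nat.lt_floor_add_one ((2 : ℝ) ^ n * s)
  have ht2 := Nat.lt_floor_add_one ((2 : ℝ) ^ n * t)
  rw [dyadicIndex, dyadicIndex] at h
  rw [h] at hs1 hs2
  rw [one_div, inv_pow, ← one_div, lt_div_iff₀ h2, ← abs_of_pos h2, ← abs_mul, abs_lt]
  constructor <;> nlinarith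

lemma ae_dyadicCell_real_pos (n : ℕ) :
    ∀ᵐ t ∂unitVolume, 0 < unitVolume.real (dyadicCell n (dyadicIndex n t)) := by
  have h : ∀ᵐ t ∂unitVolume, ∀ i, unitVolume (dyadicCell n i) = 0 → t ∉ dyadicCell n i := by
    rw [ae_all_iff]
    intro i
    by_cases hi : unitVolume (dyadicCell n i) = 0
    · filter_upwards [measure_eq_zero_iff_ae_notMem.1 hi] with t ht _ using ht
    · exact ae_of_all _ fun t h => absurd h hi
  filter_upwards [h] with t ht
  refine measureReal_nonneg.lt_of_ne fun h0 => ?_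
  rw [eq_comm, measureReal_eq_zero_iff] at h0
  exact ht _ h0 rfl

lemma ae_abs_dyadicAvg_sub_le {g : ℝ → ℝ} (hg : Integrable g unitVolume) {ε δ : ℝ}
    (h : ∀ s t, |s - t| < δ → |g s - g t| ≤ ε) {n : ℕ} (hn : (1 / 2) ^ n < δ) :
    ∀ᵐ t ∂unitVolume, |dyadicAvg n g t - g t| ≤ ε := by
  filter_upwards [ae_dyadicCell_real_pos n, ae_restrict_mem measurableSet_Ioo] with t ht ht1
  set C := dyadicCell n (dyadicIndex n t) with hC
  have h1 : dyadicAvg n g t - g t = (unitVolume.real C)⁻¹ *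
      ∫ s in C, (g s - g t) ∂unitVolume := by
    rw [integral_sub hg.integrableOn (integrable_const _), dyadicAvg, ← hC]
    simp only [integral_const, smul_eq_mul, measureReal_restrict_apply_univ]
    field_simp
  have h2 : ‖∫ s in C, (g s - g t) ∂unitVolume‖ ≤ ε * unitVolume.real C := by
    refine norm_setIntegral_le_of_norm_le_const_ae (measure_lt_top _ _) ?_
    filter_upwards [ae_restrict_of_ae (ae_restrict_mem measurableSet_Ioo),
      ae_restrict_mem (measurableSet_dyadicCell n (dyadicIndex n t))] with s hs hsC
    exact h s t ((abs_sub_lt_of_dyadicIndex_eq hs.1.le ht1.1.le hsC).trans hn)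
  rw [h1, abs_mul, abs_of_pos (inv_pos.2 ht), inv_mul_le_iff₀ ht, mul_comm]
  exact h2

variable {p : ℝ} [hp1 : Fact (1 ≤ ENNReal.ofReal p)]

lemma tendsto_dyadicProj (x : UnitLp p) :
    Tendsto (fun n => dyadicProj p n x) atTop (nhds x) := by
  rw [Metric.tendsto_atTop]
  intro ε hε
  obtain ⟨g, hgc, hgx, hgcont, hgmem⟩ := (Lp.memLp x).exists_hasCompactSupport_eLpNorm_sub_le
    ENNReal.ofReal_ne_top (ε := ENNReal.ofReal (ε / 4)) (ENNReal.ofReal_pos.2 (by positivity)).ne'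
  set y : UnitLp p := hgmem.toLp g with hy
  have hxy : ‖x - y‖ ≤ ε / 4 := by
    rw [Lp.norm_def]
    refine ENNReal.toReal_le_of_le_ofReal (by positivity) ?_
    refine le_trans (le_of_eq (eLpNorm_congr_ae ?_)) hgx
    filter_upwards [Lp.coeFn_sub x y, hgmem.coeFn_toLp] with t h1 h2
    rw [h1, Pi.sub_apply, Pi.sub_apply, ← h2]
  obtain ⟨δ, hδ, hgδ⟩ := Metric.uniformContinuous_iff.1
    (hgc.uniformContinuous_of_continuous hgcont) (ε / 4) (by positivity)
  obtain ⟨N, hN⟩ := exists_pow_lt_of_lt_one hδ (show (1 / 2 : ℝ) < 1 by norm_num)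
  refine ⟨N, fun n hn => ?_⟩
  have hyn : ‖dyadicProj p n y - y‖ ≤ ε / 4 := by
    suffices h : ∀ᵐ t ∂unitVolume, ‖(dyadicProj p n y - y) t‖ ≤ ε / 4 by
      have hbound := Lp.norm_le_of_ae_bound (by positivity) h
      rwa [show measureUnivNNReal unitVolume = 1 by simp [measureUnivNNReal], NNReal.coe_one,
        Real.one_rpow, one_mul] at hbound
    have hgi : Integrable g unitVolume := hgmem.integrable hp1.out
    have hn' : (1 / 2 : ℝ) ^ n < δ :=
      (pow_le_pow_of_le_one (by norm_num) (by norm_num) hn).trans_lt hN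
    have hav : dyadicAvg n y =ᵐ[unitVolume] dyadicAvg n g :=
      (dyadicAvg_ae_eq_condExp n (integrable_unitLp y)).trans <|
        (condExp_congr_ae hgmem.coeFn_toLp).trans (dyadicAvg_ae_eq_condExp n hgi).symm
    filter_upwards [Lp.coeFn_sub (dyadicProj p n y) y, hgmem.coeFn_toLp, coeFn_dyadicProj n y, hav,
      ae_abs_dyadicAvg_sub_le hgi (fun s t h => (hgδ h).le) hn'] with t h1 h2 h3 h4 h5
    rw [h1, Pi.sub_apply, h3, h4, h2]
    exact h5
  have hxyn := norm_dyadicProj_le n (x - y)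
  rw [map_sub] at hxyn
  calc dist (dyadicProj p n x) x
      = ‖(dyadicProj p n x - dyadicProj p n y) + (dyadicProj p n y - y) - (x - y)‖ := by
        rw [dist_eq_norm]; congr 1; abel
    _ ≤ ε / 4 + ε / 4 + ε / 4 :=
        (norm_sub_le _ _).trans (add_le_add ((norm_add_le _ _).trans
          (add_le_add (hxyn.trans hxy) hyn)) hxy)
    _ < ε := by linarith

end DyadicConvergence

section ConvexityEstimates

lemma abs_add_rpow_add_abs_sub_rpow_le {p : ℝ} (hp1 : 1 ≤ p) (hp2 : p ≤ 2) (a b : ℝ) :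
    |a + b| ^ p + |a - b| ^ p ≤ 2 * |a| ^ p + 2 * |b| ^ p := by
  have hsq (x : ℝ) : |x| ^ p = (x ^ 2) ^ (p / 2) := by
    rw [← sq_abs, ← Real.rpow_natCast, ← Real.rpow_mul (abs_nonneg x)]
    congr 1
    push_cast
    ring
  simp only [hsq]
  obtain ⟨-, hconc⟩ := Real.concaveOn_rpow (p := p / 2) (by linarith) (by linarith)
  replace hconc := hconc (show (a + b) ^ 2 ∈ Set.Ici (0 : ℝ) from Set.mem_Ici.2 (sq_nonneg _))
    (show (a - b) ^ 2 ∈ Set.Ici (0 : ℝ) from Set.mem_Ici.2 (sq_nonneg _)) (show (0 : ℝ) ≤ 1 / 2 by norm_num)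
    (show (0 : ℝ) ≤ 1 / 2 by norm_num) (by norm_num)
  have hadd := Real.rpow_add_le_add_rpow (sq_nonneg a) (sq_nonneg b)
    (p := p / 2) (by linarith) (by linarith)
  simp only [smul_eq_mul] at hconc
  rw [show 1 / 2 * (a + b) ^ 2 + 1 / 2 * (a - b) ^ 2 = a ^ 2 + b ^ 2 by ring] at hconc
  linarith

/-- The defect in the midpoint convexity of `|·| ^ p` on the segment from `a` to `a + b`. -/
noncomputable def convexityDefect (p a b : ℝ) : ℝ := (|a| ^ p + |a + b| ^ p) / 2 - |a + b / 2| ^ p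

lemma convexityDefect_pos {p : ℝ} (hp : 1 < p) (a : ℝ) {b : ℝ} (hb : b ≠ 0) :
    0 < convexityDefect p a b := by
  have hp0 : 0 < p := by linarith
  have htri : |a + b / 2| ≤ (|a| + |a + b|) / 2 := by
    rw [show a + b / 2 = (a + (a + b)) / 2 by ring, abs_div, abs_two]
    gcongr
    exact abs_add_le _ _
  rw [convexityDefect, sub_pos]
  by_cases h : |a| = |a + b|
  · have hab : a + b / 2 = 0 := by
      rcases abs_eq_abs.1 h with h | h
      · exact absurd (by linarith) hb
      · linarith
    have ha : a ≠ 0 := fun ha => hb (by linarith)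
    rw [hab, abs_zero, Real.zero_rpow hp0.ne']
    positivity
  · obtain ⟨-, hconv⟩ := strictConvexOn_rpow hp
    replace hconv := hconv (abs_nonneg a) (abs_nonneg (a + b)) h
      (show (0 : ℝ) < 1 / 2 by norm_num) (show (0 : ℝ) < 1 / 2 by norm_num) (by norm_num)
    simp only [smul_eq_mul] at hconv
    calc |a + b / 2| ^ p ≤ ((|a| + |a + b|) / 2) ^ p :=
          Real.rpow_le_rpow (abs_nonneg _) htri hp0.le
      _ = (1 / 2 * |a| + 1 / 2 * |a + b|) ^ p := by congr 1; ring
      _ < _ := hconv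
      _ = _ := by ring

lemma convexityDefect_nonneg {p : ℝ} (hp : 1 < p) (a b : ℝ) : 0 ≤ convexityDefect p a b := by
  rcases eq_or_ne b 0 with rfl | hb
  · simp [convexityDefect]
  · exact (convexityDefect_pos hp a hb).le

lemma convexityDefect_mul {p : ℝ} (a b : ℝ) :
    convexityDefect p (a * b) b = |b| ^ p * convexityDefect p a 1 := by
  rw [convexityDefect, convexityDefect, show a * b + b = (a + 1) * b by ring,
    show a * b + b / 2 = (a + 1 / 2) * b by ring]
  simp only [abs_mul]
  rw [Real.mul_rpow (abs_nonneg _) (abs_nonneg _), Real.mul_rpow (abs_nonneg _) (abs_nonneg _),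
    Real.mul_rpow (abs_nonneg _) (abs_nonneg _)]
  ring

lemma exists_abs_rpow_le_convexityDefect {p : ℝ} (hp : 1 < p) {ε : ℝ} (hε : 0 < ε) :
    ∃ C, 0 < C ∧ ∀ a b : ℝ, |b| ^ p ≤ ε * |a| ^ p + C * convexityDefect p a b := by
  have hp0 : 0 < p := by linarith
  set R : ℝ := (1 / ε) ^ p⁻¹ with hR
  have hR0 : 0 < R := by positivity
  have hcont : Continuous fun s : ℝ => convexityDefect p s 1 := by
    unfold convexityDefect
    have (c : ℝ) : Continuous fun s : ℝ => |s + c| ^ p :=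
      (continuous_abs.comp (continuous_add_const c)).rpow_const fun _ => Or.inr hp0.le
    have h0 := this 0
    simp only [add_zero] at h0
    exact ((h0.add (this 1)).div_const 2).sub (this (1 / 2))
  obtain ⟨s₀, -, hs₀⟩ := (isCompact_Icc (a := -R) (b := R)).exists_isMinOn
    ⟨0, by constructor <;> linarith⟩ hcont.continuousOn
  have hpos := convexityDefect_pos hp s₀ one_ne_zero
  refine ⟨(convexityDefect p s₀ 1)⁻¹, inv_pos.2 hpos, fun a b => ?_⟩
  have hnn := convexityDefect_nonneg hp a b
  have hinv := inv_pos.2 hpos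
  by_cases h : |b| ^ p ≤ ε * |a| ^ p
  · have := mul_nonneg hinv.le hnn
    linarith
  · push Not at h
    have hb : b ≠ 0 := by
      rintro rfl
      rw [abs_zero, Real.zero_rpow hp0.ne'] at h
      have : 0 ≤ ε * |a| ^ p := by positivity
      linarith
    have hbpos : 0 < |b| := abs_pos.2 hb
    have hab : |a / b| ≤ R := by
      rw [abs_div, div_le_iff₀ hbpos, ← Real.rpow_le_rpow_iff (abs_nonneg _) (by positivity) hp0,
        Real.mul_rpow hR0.le hbpos.le, hR, ← Real.rpow_mul (by positivity),
        inv_mul_cancel₀ hp0.ne', Real.rpow_one, one_div, inv_mul_eq_div, le_div_iff₀ hε, mul_comm]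
      exact h.le
    have hmin : convexityDefect p s₀ 1 ≤ convexityDefect p (a / b) 1 := hs₀ (abs_le.1 hab)
    have hmul := convexityDefect_mul (p := p) (a / b) b
    rw [div_mul_cancel₀ a hb] at hmul
    have h1 : |b| ^ p ≤ (convexityDefect p s₀ 1)⁻¹ * convexityDefect p a b := by
      rw [hmul, le_inv_mul_iff₀ hpos, mul_comm]
      gcongr
    have : 0 ≤ ε * |a| ^ p := by positivity
    linarith

variable {p : ℝ} [Fact (1 ≤ ENNReal.ofReal p)]

lemma norm_le_norm_add_of_dyadicProj {m : ℕ} {a b : UnitLp p} (ha : dyadicProj p m a = a)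
    (hb : dyadicProj p m b = 0) : ‖a‖ ≤ ‖a + b‖ := by
  simpa [ha, hb] using norm_dyadicProj_le m (a + b)

/-- The upper `p`-estimate for martingale differences. -/
lemma norm_add_rpow_le_of_dyadicProj (hp1 : 1 ≤ p) (hp2 : p ≤ 2) {m : ℕ} {a b : UnitLp p}
    (ha : dyadicProj p m a = a) (hb : dyadicProj p m b = 0) :
    ‖a + b‖ ^ p ≤ ‖a‖ ^ p + 2 * ‖b‖ ^ p := by
  have hp0 : 0 < p := by linarith
  have hle : ‖a‖ ^ p ≤ ‖a - b‖ ^ p := by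
    rw [sub_eq_add_neg]
    exact Real.rpow_le_rpow (norm_nonneg _)
      (norm_le_norm_add_of_dyadicProj ha (by simp [hb])) hp0.le
  have hint : ‖a + b‖ ^ p + ‖a - b‖ ^ p ≤ 2 * ‖a‖ ^ p + 2 * ‖b‖ ^ p := by
    simp only [norm_rpow_eq_integral hp0]
    rw [← integral_const_mul, ← integral_const_mul,
      ← integral_add (integrable_abs_rpow hp0 _) (integrable_abs_rpow hp0 _),
      ← integral_add ((integrable_abs_rpow hp0 _).const_mul _)
        ((integrable_abs_rpow hp0 _).const_mul _)]
    refine integral_mono_ae ((integrable_abs_rpow hp0 _).add (integrable_abs_rpow hp0 _))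
      (((integrable_abs_rpow hp0 _).const_mul _).add ((integrable_abs_rpow hp0 _).const_mul _)) ?_
    filter_upwards [Lp.coeFn_add a b, Lp.coeFn_sub a b] with t h1 h2
    simp only [h1, h2, Pi.add_apply, Pi.sub_apply]
    exact abs_add_rpow_add_abs_sub_rpow_le hp1 hp2 _ _
  linarith

/-- Lower estimates for martingale differences follow from pointwise bounds by the convexity
defect. -/
lemma norm_rpow_le_of_ae_le_convexityDefect (hp : 1 < p) {m : ℕ} {a b v : UnitLp p}
    (ha : dyadicProj p m a = a) (hb : dyadicProj p m b = 0) {ε C : ℝ} (hC : 0 ≤ C)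
    (h : ∀ᵐ t ∂unitVolume, |v t| ^ p ≤ ε * |a t| ^ p + C * convexityDefect p (a t) (b t)) :
    ‖v‖ ^ p ≤ ε * ‖a‖ ^ p + C / 2 * (‖a + b‖ ^ p - ‖a‖ ^ p) := by
  have hp0 : 0 < p := by linarith
  have hle : ‖a‖ ^ p ≤ ‖a + (1 / 2 : ℝ) • b‖ ^ p :=
    Real.rpow_le_rpow (norm_nonneg _) (norm_le_norm_add_of_dyadicProj ha (by simp [hb])) hp0.le
  have hint : ‖v‖ ^ p + C * ‖a + (1 / 2 : ℝ) • b‖ ^ p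
      ≤ (ε + C / 2) * ‖a‖ ^ p + C / 2 * ‖a + b‖ ^ p := by
    simp only [norm_rpow_eq_integral hp0]
    rw [← integral_const_mul, ← integral_const_mul, ← integral_const_mul,
      ← integral_add (integrable_abs_rpow hp0 _) ((integrable_abs_rpow hp0 _).const_mul _),
      ← integral_add ((integrable_abs_rpow hp0 _).const_mul _)
        ((integrable_abs_rpow hp0 _).const_mul _)]
    refine integral_mono_ae
      ((integrable_abs_rpow hp0 _).add ((integrable_abs_rpow hp0 _).const_mul _))
      (((integrable_abs_rpow hp0 _).const_mul _).add ((integrable_abs_rpow hp0 _).const_mul _)) ?_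
    filter_upwards [h, Lp.coeFn_add a b, Lp.coeFn_add a ((1 / 2 : ℝ) • b),
      Lp.coeFn_smul (1 / 2 : ℝ) b] with t h0 h1 h2 h3
    simp only [h1, h2, h3, Pi.add_apply, Pi.smul_apply, smul_eq_mul]
    rw [convexityDefect] at h0
    rw [show a t + 1 / 2 * b t = a t + b t / 2 by ring]
    linarith
  have := mul_le_mul_of_nonneg_left hle hC
  linarith

end ConvexityEstimates

section DyadicCompactness

variable {p : ℝ} [Fact (1 ≤ ENNReal.ofReal p)]

/-- Bounded dyadic martingales converge. -/
lemma exists_tendsto_of_dyadicProj_eq (hp : 1 < p) {y : ℕ → UnitLp p} {B : ℝ}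
    (hy : ∀ m l, m ≤ l → dyadicProj p m (y l) = y m) (hB : ∀ m, ‖y m‖ ≤ B) :
    ∃ x, Tendsto y atTop (nhds x) ∧ ∀ m, dyadicProj p m x = y m := by
  have hp0 : 0 < p := by linarith
  have hB0 : 0 ≤ B := (norm_nonneg _).trans (hB 0)
  have hmono : Monotone fun m => ‖y m‖ ^ p := fun m l h => by
    refine Real.rpow_le_rpow (norm_nonneg _) ?_ hp0.le
    rw [← hy m l h]
    exact norm_dyadicProj_le m (y l)
  have hbdd : BddAbove (Set.range fun m => ‖y m‖ ^ p) := by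
    refine ⟨B ^ p, ?_⟩
    rintro _ ⟨m, rfl⟩
    exact Real.rpow_le_rpow (norm_nonneg _) (hB m) hp0.le
  have hlim := tendsto_atTop_ciSup hmono hbdd
  have hcauchy : CauchySeq y := by
    rw [Metric.cauchySeq_iff']
    intro ε hε
    have hεp : 0 < ε ^ p := by positivity
    have hBp : 0 ≤ B ^ p := by positivity
    obtain ⟨C, hC, hdef⟩ := exists_abs_rpow_le_convexityDefect hp
      (show 0 < ε ^ p / 2 / (B ^ p + 1) by positivity)
    obtain ⟨N, hN⟩ := (hlim.eventually_const_lt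
      (show (⨆ m, ‖y m‖ ^ p) - ε ^ p / C < ⨆ m, ‖y m‖ ^ p from
        sub_lt_self _ (by positivity))).exists
    refine ⟨N, fun n hn => ?_⟩
    rw [dist_eq_norm, ← Real.rpow_lt_rpow_iff (norm_nonneg _) hε.le hp0]
    have ha : dyadicProj p N (y N) = y N := hy N N le_rfl
    have hb : dyadicProj p N (y n - y N) = 0 := by rw [map_sub, hy N n hn, ha, sub_self]
    have h := norm_rpow_le_of_ae_le_convexityDefect hp ha hb (v := y n - y N) hC.le
      (ae_of_all _ fun t => hdef _ _)
    rw [add_sub_cancel] at h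
    have h1 : ε ^ p / 2 / (B ^ p + 1) * ‖y N‖ ^ p ≤ ε ^ p / 2 := by
      rw [div_mul_eq_mul_div, div_le_iff₀ (by positivity)]
      gcongr
      linarith [Real.rpow_le_rpow (norm_nonneg _) (hB N) hp0.le]
    have h2 : ‖y n‖ ^ p ≤ ⨆ m, ‖y m‖ ^ p := le_ciSup hbdd n
    have h3 : C / 2 * (‖y n‖ ^ p - ‖y N‖ ^ p) < C / 2 * (ε ^ p / C) := by
      gcongr
      linarith
    have h4 : C / 2 * (ε ^ p / C) = ε ^ p / 2 := by field_simp
    linarith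
  obtain ⟨x, hx⟩ := cauchySeq_tendsto_of_complete hcauchy
  refine ⟨x, hx, fun m => tendsto_nhds_unique (((dyadicProj p m).continuous.tendsto x).comp hx) ?_⟩
  refine tendsto_const_nhds.congr' ?_
  filter_upwards [eventually_ge_atTop m] with l hl using (hy m l hl).symm

/-- Every bounded sequence has a subsequence whose conditional expectations all converge to those
of a single function. -/
lemma exists_subseq_tendsto_dyadicProj (hp : 1 < p) {x : ℕ → UnitLp p} {B : ℝ}
    (hB : ∀ k, ‖x k‖ ≤ B) :
    ∃ (z : UnitLp p) (σ : ℕ → ℕ), StrictMono σ ∧ ‖z‖ ≤ B ∧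
      ∀ m, Tendsto (fun k => dyadicProj p m (x (σ k))) atTop (nhds (dyadicProj p m z)) := by
  have hmem (k : ℕ) : (fun q : ℕ × ℕ => cellIntegral p q.1 q.2 (x k)) ∈
      Set.univ.pi fun q : ℕ × ℕ =>
        Metric.closedBall (0 : ℝ) (‖cellIntegral p q.1 q.2‖ * B) := by
    intro q _
    rw [mem_closedBall_zero_iff]
    exact ((cellIntegral p q.1 q.2).le_opNorm _).trans (by gcongr; exact hB k)
  obtain ⟨c, -, σ, hσ, hc⟩ := (isCompact_univ_pi fun q : ℕ × ℕ =>
    isCompact_closedBall (0 : ℝ) (‖cellIntegral p q.1 q.2‖ * B)).tendsto_subseq hmem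
  rw [tendsto_pi_nhds] at hc
  choose y hy using fun m => tendsto_dyadicProj_of_tendsto_cellIntegral (n := m)
    (x := fun k => x (σ k)) (c := fun i => c (m, i)) fun i => hc (m, i)
  obtain ⟨z, hz, hzy⟩ := exists_tendsto_of_dyadicProj_eq hp (y := y) (B := B) (fun m l hml => by
      refine tendsto_nhds_unique (((dyadicProj p m).continuous.tendsto _).comp (hy l)) ?_
      refine (hy m).congr fun k => ?_
      exact (dyadicProj_dyadicProj_of_le hml _).symm)
    fun m => le_of_tendsto (hy m).norm (Eventually.of_forall fun k =>
      (norm_dyadicProj_le _ _).trans (hB _))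
  refine ⟨z, σ, hσ, le_of_tendsto hz.norm (Eventually.of_forall fun m =>
    le_of_tendsto (hy m).norm (Eventually.of_forall fun k =>
      (norm_dyadicProj_le _ _).trans (hB _))), fun m => ?_⟩
  rw [hzy]
  exact hy m

end DyadicCompactness

section DyadicWeakConvergence

variable {p : ℝ} [Fact (1 ≤ ENNReal.ofReal p)]

lemma eventually_apply_lt_of_tendsto_dyadicProj (hp : 1 < p) (hp2 : p ≤ 2) {w : ℕ → UnitLp p}
    {B : ℝ} (hB : ∀ n, ‖w n‖ ≤ B) (h : ∀ m, Tendsto (fun n => dyadicProj p m (w n)) atTop (nhds 0))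
    (φ : UnitLp p →L[ℝ] ℝ) {ε : ℝ} (hε : 0 < ε) : ∀ᶠ n in atTop, φ (w n) < ε := by
  have hp0 : 0 < p := by linarith
  have hB0 : 0 ≤ B := (norm_nonneg _).trans (hB 0)
  set K : ℝ := ‖φ‖ * (2 * (2 * B) ^ p) + 1 with hK
  have hK0 : 0 < K := by positivity
  obtain ⟨t, ht, htK⟩ : ∃ t : ℝ, 0 < t ∧ t ^ p = t * (ε / 4 / K) := by
    refine ⟨(ε / 4 / K) ^ (p - 1)⁻¹, by positivity, ?_⟩
    have h0 : 0 < ε / 4 / K := by positivity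
    rw [← Real.rpow_mul h0.le, ← Real.rpow_add_one h0.ne']
    congr 1
    have : p - 1 ≠ 0 := by linarith
    field_simp
    ring
  obtain ⟨m, a, ham, ha1, haφ⟩ : ∃ (m : ℕ) (a : UnitLp p), dyadicProj p m a = a ∧ ‖a‖ ≤ 1 ∧
      ‖φ‖ - t * (ε / 4) < φ a := by
    obtain ⟨a, ha, hφa⟩ : ∃ a : UnitLp p, ‖a‖ ≤ 1 ∧ ‖φ‖ - t * (ε / 4) < φ a := by
      obtain ⟨a, ha, hφa⟩ := φ.exists_lt_apply_of_lt_opNorm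
        (show ‖φ‖ - t * (ε / 4) < ‖φ‖ from sub_lt_self _ (by positivity))
      rcases le_total 0 (φ a) with h0 | h0
      · exact ⟨a, ha.le, by rwa [Real.norm_of_nonneg h0] at hφa⟩
      · exact ⟨-a, by simpa using ha.le, by rwa [Real.norm_of_nonpos h0, ← map_neg] at hφa⟩
    obtain ⟨m, hm⟩ := (((φ.continuous.tendsto _).comp
      (tendsto_dyadicProj a)).eventually_const_lt hφa).exists
    exact ⟨m, dyadicProj p m a, dyadicProj_dyadicProj_of_ge le_rfl a,
      (norm_dyadicProj_le m a).trans ha, hm⟩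
  have hlim : Tendsto (fun n => φ (dyadicProj p m (w n))) atTop (nhds 0) := by
    simpa [Function.comp_def] using (φ.continuous.tendsto _).comp (h m)
  filter_upwards [hlim.eventually_lt_const (show 0 < ε / 4 by positivity)] with n hn
  set b := w n - dyadicProj p m (w n) with hb
  have hbm : dyadicProj p m (t • b) = 0 := by
    rw [map_smul, hb, map_sub, dyadicProj_dyadicProj_of_ge le_rfl, sub_self, smul_zero]
  have hbB : ‖b‖ ≤ 2 * B := by
    refine (norm_sub_le _ _).trans ?_
    linarith [norm_dyadicProj_le m (w n), hB n]
  have hs : ‖t • b‖ ^ p ≤ t * (ε / 4 / K) * (2 * B) ^ p := by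
    rw [norm_smul, Real.norm_of_nonneg ht.le, Real.mul_rpow ht.le (norm_nonneg _), htK]
    gcongr
  have hup : ‖a + t • b‖ ≤ 1 + 2 * (t * (ε / 4 / K) * (2 * B) ^ p) := by
    have h1 := norm_add_rpow_le_of_dyadicProj hp.le hp2 ham hbm
    have h2 : ‖a‖ ^ p ≤ 1 := Real.rpow_le_one (norm_nonneg _) ha1 hp0.le
    have h3 : 0 ≤ t * (ε / 4 / K) * (2 * B) ^ p := by positivity
    rw [← Real.rpow_le_rpow_iff (norm_nonneg _) (by positivity) hp0]
    calc ‖a + t • b‖ ^ p ≤ 1 + 2 * (t * (ε / 4 / K) * (2 * B) ^ p) := by linarith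
      _ ≤ _ := Real.self_le_rpow_of_one_le (by linarith) hp.le
  have hφ : φ a + t * φ b ≤ ‖φ‖ * (1 + 2 * (t * (ε / 4 / K) * (2 * B) ^ p)) := by
    rw [← smul_eq_mul t, ← map_smul, ← map_add]
    exact (le_abs_self _).trans ((φ.le_opNorm _).trans (by gcongr))
  have hK1 : ‖φ‖ * (2 * (t * (ε / 4 / K) * (2 * B) ^ p)) ≤ t * (ε / 4) := by
    have : ‖φ‖ * (2 * (t * (ε / 4 / K) * (2 * B) ^ p)) = t * (ε / 4) * ((K - 1) / K) := by
      rw [hK]; ring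
    rw [this]
    refine mul_le_of_le_one_right (by positivity) ?_
    rw [div_le_one hK0]
    linarith
  have hφb : φ b ≤ ε / 2 := by
    have : t * φ b ≤ t * (ε / 2) := by linarith
    exact le_of_mul_le_mul_left this ht
  have hw : w n = dyadicProj p m (w n) + b := by rw [hb, add_sub_cancel]
  rw [hw, map_add]
  linarith

/-- Bounded sequences all of whose conditional expectations converge are weakly convergent. -/
lemma tendsto_apply_of_tendsto_dyadicProj (hp : 1 < p) (hp2 : p ≤ 2) {w : ℕ → UnitLp p}
    {z : UnitLp p} {B : ℝ} (hB : ∀ n, ‖w n‖ ≤ B)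
    (h : ∀ m, Tendsto (fun n => dyadicProj p m (w n)) atTop (nhds (dyadicProj p m z)))
    (φ : UnitLp p →L[ℝ] ℝ) : Tendsto (fun n => φ (w n)) atTop (nhds (φ z)) := by
  have hB' (n : ℕ) : ‖w n - z‖ ≤ B + ‖z‖ := (norm_sub_le _ _).trans (by gcongr; exact hB n)
  have h' (m : ℕ) : Tendsto (fun n => dyadicProj p m (w n - z)) atTop (nhds 0) := by
    simpa using (h m).sub_const (dyadicProj p m z)
  rw [← tendsto_sub_nhds_zero_iff, tendsto_order]
  refine ⟨fun ε hε => ?_, fun ε hε => ?_⟩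
  · filter_upwards [eventually_apply_lt_of_tendsto_dyadicProj hp hp2 hB' h' (-φ)
      (neg_pos.2 hε)] with n hn
    simp only [neg_apply, map_sub] at hn
    linarith
  · filter_upwards [eventually_apply_lt_of_tendsto_dyadicProj hp hp2 hB' h' φ hε] with n hn
    simpa using hn

lemma mem_of_tendsto_dyadicProj (hp : 1 < p) (hp2 : p ≤ 2) {X : Submodule ℝ (UnitLp p)}
    (hX : IsClosed (X : Set (UnitLp p))) {w : ℕ → UnitLp p} {z : UnitLp p} {B : ℝ}
    (hwX : ∀ n, w n ∈ X) (hB : ∀ n, ‖w n‖ ≤ B)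
    (h : ∀ m, Tendsto (fun n => dyadicProj p m (w n)) atTop (nhds (dyadicProj p m z))) :
    z ∈ X := by
  by_contra hz
  obtain ⟨φ, u, hzu, hu⟩ := geometric_hahn_banach_point_closed X.convex hX hz
  have := ge_of_tendsto (tendsto_apply_of_tendsto_dyadicProj hp hp2 hB h φ)
    (Eventually.of_forall fun n => (hu _ (hwX n)).le)
  linarith

lemma tendsto_dual_of_tendsto_dyadicProj (hp : 1 < p) (hp2 : p ≤ 2)
    {X : Submodule ℝ (UnitLp p)} {w : ℕ → X} {z : X} {B : ℝ} (hB : ∀ n, ‖w n‖ ≤ B)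
    (h : ∀ m, Tendsto (fun n => dyadicProj p m (w n)) atTop (nhds (dyadicProj p m z)))
    (φ : X →L[ℝ] ℝ) : Tendsto (fun n => φ (w n)) atTop (nhds (φ z)) := by
  obtain ⟨g, hg, -⟩ := exists_extension_norm_eq X φ
  simp only [← hg]
  exact tendsto_apply_of_tendsto_dyadicProj hp hp2 (B := B) hB h g

end DyadicWeakConvergence

section CoarseMaps

lemma lp_hasSum_abs_rpow {p : ℝ} (hp : 0 < p) (y : lp (fun _ : ℕ => ℝ) (ENNReal.ofReal p)) :
    HasSum (fun i => |y i| ^ p) (‖y‖ ^ p) := by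
  have h := lp.hasSum_norm (p := ENNReal.ofReal p) (by rwa [ENNReal.toReal_ofReal hp.le]) y
  simpa only [ENNReal.toReal_ofReal hp.le, Real.norm_eq_abs] using h

/-- Coordinatewise convergence in `ℓ_p` without norm convergence increases the `p`-th power of the
norm. -/
lemma lp_eventually_le_norm_rpow {p : ℝ} (hp1 : 1 ≤ p) (hp2 : p ≤ 2)
    [Fact (1 ≤ ENNReal.ofReal p)] {y : ℕ → lp (fun _ : ℕ => ℝ) (ENNReal.ofReal p)}
    {z : lp (fun _ : ℕ => ℝ) (ENNReal.ofReal p)}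
    (h : ∀ i, Tendsto (fun n => y n i) atTop (nhds (z i))) {b : ℝ} (hb0 : 0 ≤ b)
    (hb : ∀ᶠ n in atTop, b ≤ ‖y n - z‖) {ε : ℝ} (hε : 0 < ε) :
    ∀ᶠ n in atTop, ‖z‖ ^ p + b ^ p / 2 - ε ≤ ‖y n‖ ^ p := by
  have hp0 : 0 < p := by linarith
  obtain ⟨F, hF⟩ := ((lp_hasSum_abs_rpow hp0 z).eventually_const_lt
    (show ‖z‖ ^ p - ε / 2 < ‖z‖ ^ p by linarith)).exists
  have hlim : Tendsto (fun n => ∑ i ∈ F, (|y n i| ^ p - |y n i - z i| ^ p / 2 + |z i| ^ p)) atTop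
      (nhds (∑ i ∈ F, 2 * |z i| ^ p)) := by
    refine tendsto_finsetSum _ fun i _ => ?_
    have h1 := (h i).abs.rpow_const (p := p) (Or.inr hp0.le)
    have h2 := ((h i).sub_const (z i)).abs.rpow_const (p := p) (Or.inr hp0.le)
    have h3 := (h1.sub (h2.div_const 2)).add_const (|z i| ^ p)
    rw [sub_self, abs_zero, Real.zero_rpow hp0.ne', zero_div, sub_zero, ← two_mul] at h3
    exact h3
  rw [← Finset.mul_sum] at hlim
  filter_upwards [hb, hlim.eventually_const_lt
    (show 2 * ‖z‖ ^ p - ε < 2 * ∑ i ∈ F, |z i| ^ p by linarith)] with n hn hsum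
  have hs := ((lp_hasSum_abs_rpow hp0 (y n)).sub
    ((lp_hasSum_abs_rpow hp0 (y n - z)).div_const 2)).add (lp_hasSum_abs_rpow hp0 z)
  have hle := sum_le_hasSum F (fun i _ => by
    have := abs_add_rpow_add_abs_sub_rpow_le hp1 hp2 (y n i) (z i)
    have h0 : 0 ≤ |y n i + z i| ^ p := by positivity
    change 0 ≤ |y n i| ^ p - |y n i - z i| ^ p / 2 + |z i| ^ p
    linarith) hs
  have hpow := Real.rpow_le_rpow hb0 hn hp0.le
  change ∑ i ∈ F, (|y n i| ^ p - |y n i - z i| ^ p / 2 + |z i| ^ p) ≤ _ at hle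
  linarith

lemma Coarse.exists_norm_sub_le {X Y : Type*} [NormedAddCommGroup X] [NormedSpace ℝ X]
    [NormedAddCommGroup Y] {f : X → Y} (hf : Coarse f) :
    ∃ C, 0 ≤ C ∧ ∀ x, ‖f x - f 0‖ ≤ C * (‖x‖ + 1) := by
  obtain ⟨C, hC⟩ := hf 1 zero_le_one
  have hC0 : 0 ≤ C := (norm_nonneg _).trans (hC 0 0 (by simp))
  refine ⟨C, hC0, fun x => ?_⟩
  have key (n : ℕ) : ∀ x, ‖x‖ ≤ n → ‖f x - f 0‖ ≤ C * n := by
    induction n with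
    | zero =>
      intro x hx
      have : x = 0 := by simpa using hx
      simp [this]
    | succ n ih =>
      intro x hx
      push_cast at hx ⊢
      have hn : (0 : ℝ) < n + 1 := by positivity
      have h1 : ‖((n : ℝ) / (n + 1)) • x‖ ≤ n := by
        rw [norm_smul, Real.norm_of_nonneg (by positivity), div_mul_eq_mul_div, div_le_iff₀ hn]
        gcongr
      have h2 : ‖x - ((n : ℝ) / (n + 1)) • x‖ ≤ 1 := by
        have : x - ((n : ℝ) / (n + 1)) • x = ((1 : ℝ) / (n + 1)) • x := by
          nth_rewrite 1 [← one_smul ℝ x]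
          rw [← sub_smul]
          congr 1
          field_simp
          ring
        rw [this, norm_smul, Real.norm_of_nonneg (by positivity), div_mul_eq_mul_div,
          div_le_iff₀ hn]
        linarith
      calc ‖f x - f 0‖ ≤ ‖f x - f (((n : ℝ) / (n + 1)) • x)‖
            + ‖f (((n : ℝ) / (n + 1)) • x) - f 0‖ := norm_sub_le_norm_sub_add_norm_sub _ _ _
        _ ≤ C + C * n := add_le_add (hC _ _ h2) (ih _ h1)
        _ = C * (n + 1) := by ring
  refine (key ⌈‖x‖⌉₊ x (Nat.le_ceil _)).trans ?_
  gcongr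
  exact (Nat.ceil_lt_add_one (norm_nonneg _)).le

end CoarseMaps

section StrongEmbedding

instance fact_one_le_ofReal_two : Fact (1 ≤ ENNReal.ofReal 2) := ⟨by simp⟩

variable {p : ℝ}

/-- The inclusion of `L_2(0,1)` in `L_p(0,1)`. -/
noncomputable def inclLp (hp2 : p ≤ 2) : UnitLp 2 →+ UnitLp p :=
  AddSubgroup.inclusion (Lp.antitone (ENNReal.ofReal_le_ofReal hp2))

lemma coeFn_inclLp (hp2 : p ≤ 2) (u : UnitLp 2) : ⇑(inclLp hp2 u) = u := rfl

lemma norm_inclLp_le (hp2 : p ≤ 2) (u : UnitLp 2) : ‖inclLp hp2 u‖ ≤ ‖u‖ := by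
  rw [Lp.norm_def, Lp.norm_def, coeFn_inclLp]
  exact ENNReal.toReal_mono (Lp.eLpNorm_ne_top u) (eLpNorm_le_eLpNorm_of_exponent_le
    (ENNReal.ofReal_le_ofReal hp2) (Lp.aestronglyMeasurable u))

variable [Fact (1 ≤ ENNReal.ofReal p)]

lemma inclLp_dyadicProj (hp2 : p ≤ 2) (n : ℕ) (u : UnitLp 2) :
    inclLp hp2 (dyadicProj 2 n u) = dyadicProj p n (inclLp hp2 u) := by
  refine Lp.ext ?_
  rw [coeFn_inclLp]
  exact (coeFn_dyadicProj n u).trans (coeFn_dyadicProj n (inclLp hp2 u)).symm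

lemma norm_dyadicProj_sub_le {m n : ℕ} (x : UnitLp p) :
    ‖dyadicProj p n x - dyadicProj p m x‖ ≤ 2 * ‖x‖ := by
  refine (norm_sub_le _ _).trans ?_
  linarith [norm_dyadicProj_le n x, norm_dyadicProj_le m x]

lemma dyadicProj_dyadicProj_sub {m n : ℕ} (h : m ≤ n) (x : UnitLp p) :
    dyadicProj p m (dyadicProj p n x - dyadicProj p m x) = 0 := by
  rw [map_sub, dyadicProj_dyadicProj_of_le h, dyadicProj_dyadicProj_of_ge le_rfl, sub_self]

lemma norm_add_dyadicProj_sub_rpow_le (hp1 : 1 ≤ p) (hp2 : p ≤ 2) {m n : ℕ} (h : m ≤ n)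
    {a x : UnitLp p} (ha : dyadicProj p m a = a) {R : ℝ} (hx : ‖x‖ ≤ R) :
    ‖a + (dyadicProj p n x - dyadicProj p m x)‖ ^ p ≤ ‖a‖ ^ p + 2 * (2 * R) ^ p := by
  refine (norm_add_rpow_le_of_dyadicProj hp1 hp2 ha (dyadicProj_dyadicProj_sub h x)).trans ?_
  have hR := (norm_nonneg _).trans hx
  have : ‖dyadicProj p n x - dyadicProj p m x‖ ^ p ≤ (2 * R) ^ p :=
    Real.rpow_le_rpow (norm_nonneg _) ((norm_dyadicProj_sub_le x).trans (by gcongr)) (by linarith)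
  linarith

lemma dyadicProj_add_dyadicProj_sub {m n : ℕ} (h : m ≤ n)
    {a : UnitLp p} (ha : dyadicProj p m a = a) (x : UnitLp p) :
    dyadicProj p n (a + (dyadicProj p n x - dyadicProj p m x)) =
      a + (dyadicProj p n x - dyadicProj p m x) := by
  rw [map_add, map_sub, dyadicProj_dyadicProj_of_ge le_rfl, dyadicProj_dyadicProj_of_ge h]
  congr 1
  rw [← ha, dyadicProj_dyadicProj_of_ge h]

/-- Sums of `K` essentially disjoint terms of a sequence which is uniformly close to a bounded
sequence of `L_2(0,1)`, together with the growth of the images under `f`. -/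
lemma exists_sum_of_near_inclLp (hp1 : 1 < p) (hp2 : p ≤ 2) {X : Submodule ℝ (UnitLp p)}
    {f : X → lp (fun _ : ℕ => ℝ) (ENNReal.ofReal p)} (hf : WeakSeqCont f)
    {α β b : ℝ} (hb0 : 0 ≤ b)
    (hb : ∀ x y : X, α ≤ ‖x - y‖ → ‖x - y‖ ≤ β → b ≤ ‖f x - f y‖)
    {w : ℕ → X} (hwα : ∀ n, α ≤ ‖w n‖) (hwβ : ∀ n, ‖w n‖ ≤ β)
    (hw : ∀ m, Tendsto (fun n => dyadicProj p m (w n)) atTop (nhds 0))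
    {u : ℕ → UnitLp 2} {M δ : ℝ} (hu : ∀ n, ‖u n‖ ≤ M)
    (huw : ∀ᶠ n in atTop, ‖(w n : UnitLp p) - inclLp hp2 (u n)‖ ≤ δ)
    {η : ℝ} (hη : 0 < η) (K : ℕ) :
    ∃ (m : ℕ) (s : X) (U : UnitLp 2) (V : UnitLp p), dyadicProj 2 m U = U ∧ dyadicProj p m V = V ∧
      ‖(s : UnitLp p) - inclLp hp2 U - V‖ ≤ K * η ∧ ‖U‖ ^ (2 : ℝ) ≤ 2 * (2 * M) ^ (2 : ℝ) * K ∧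
      ‖V‖ ^ p ≤ 2 * (2 * δ) ^ p * K ∧ K * (b ^ p / 2 - η) ≤ ‖f s - f 0‖ ^ p := by
  have hp0 : 0 < p := by linarith
  induction K with
  | zero =>
    refine ⟨0, 0, 0, 0, map_zero _, map_zero _, ?_⟩
    simp [hp0.ne']
  | succ K ih =>
    obtain ⟨m, s, U, V, hU, hV, hs, hU2, hVp, hfs⟩ := ih
    have hweak (i : ℕ) : Tendsto (fun n => (f (s + w n) - f 0) i) atTop
        (nhds ((f s - f 0) i)) := by
      have h := hf (fun n => s + w n) s (fun φ => by
        refine tendsto_dual_of_tendsto_dyadicProj hp1 hp2 (B := ‖s‖ + β)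
          (fun n => (norm_add_le _ _).trans (by gcongr; exact hwβ n)) (fun l => ?_) φ
        simpa using (hw l).const_add (dyadicProj p l s)) (lp.evalCLM ℝ _ (ENNReal.ofReal p) i)
      exact h.sub_const ((f 0) i)
    have hfar : ∀ᶠ n in atTop, b ≤ ‖(f (s + w n) - f 0) - (f s - f 0)‖ :=
      Eventually.of_forall fun n => by
        rw [sub_sub_sub_cancel_right]
        exact hb _ _ (by simpa using hwα n) (by simpa using hwβ n)
    have hsmall : ∀ᶠ n in atTop, ‖dyadicProj p m (w n)‖ < η / 2 := by
      have := (hw m).norm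
      rw [norm_zero] at this
      exact this.eventually_lt_const (by positivity)
    obtain ⟨n, hn1, hn2, hn3⟩ := (huw.and (hsmall.and
      (lp_eventually_le_norm_rpow hp1.le hp2 hweak hb0 hfar hη))).exists
    obtain ⟨l, hml, hl⟩ : ∃ l, m ≤ l ∧ ‖(w n : UnitLp p) - dyadicProj p l (w n)‖ < η / 2 := by
      have h := (((tendsto_dyadicProj (w n : UnitLp p)).const_sub (w n : UnitLp p)).norm)
      rw [sub_self, norm_zero] at h
      exact ((eventually_ge_atTop m).and (h.eventually_lt_const (by positivity))).exists
    refine ⟨l, s + w n, U + (dyadicProj 2 l (u n) - dyadicProj 2 m (u n)),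
      V + (dyadicProj p l ((w n : UnitLp p) - inclLp hp2 (u n)) -
        dyadicProj p m ((w n : UnitLp p) - inclLp hp2 (u n))),
      dyadicProj_add_dyadicProj_sub hml hU _, dyadicProj_add_dyadicProj_sub hml hV _, ?_, ?_, ?_, ?_⟩
    · have : ((s + w n : X) : UnitLp p)
          - inclLp hp2 (U + (dyadicProj 2 l (u n) - dyadicProj 2 m (u n)))
          - (V + (dyadicProj p l ((w n : UnitLp p) - inclLp hp2 (u n)) -
            dyadicProj p m ((w n : UnitLp p) - inclLp hp2 (u n)))) =
          ((s : UnitLp p) - inclLp hp2 U - V) + ((w n : UnitLp p) - dyadicProj p l (w n)) +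
            dyadicProj p m (w n) := by
        simp only [map_add, map_sub, inclLp_dyadicProj, Submodule.coe_add]
        abel
      rw [this]
      push_cast
      linarith [norm_add₃_le (a := (s : UnitLp p) - inclLp hp2 U - V)
        (b := (w n : UnitLp p) - dyadicProj p l (w n)) (c := dyadicProj p m (w n))]
    · have := norm_add_dyadicProj_sub_rpow_le one_le_two le_rfl hml hU (hu n)
      push_cast
      linarith
    · have := norm_add_dyadicProj_sub_rpow_le hp1.le hp2 hml hV hn1
      push_cast
      linarith
    · push_cast
      linarith

lemma le_rpow_of_forall_nat_mul_le {p : ℝ} (hp0 : 0 < p) (hp2 : p < 2) {A B C D : ℝ}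
    (hA : 0 ≤ A) (hC : 0 ≤ C) (hD : 0 ≤ D)
    (h : ∀ K : ℕ, 0 < K → K * B - 1 ≤
      (C * (2 + A * (K : ℝ) ^ (2 : ℝ)⁻¹ + D * (K : ℝ) ^ p⁻¹)) ^ p) :
    B ≤ (C * D) ^ p := by
  have hneg (r : ℝ) (hr : 0 < r) : Tendsto (fun K : ℕ => (K : ℝ) ^ (-r)) atTop (nhds 0) :=
    (tendsto_rpow_neg_atTop hr).comp tendsto_natCast_atTop_atTop
  have hpinv : (2 : ℝ)⁻¹ < p⁻¹ := inv_strictAnti₀ hp0 hp2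
  have hr : Tendsto (fun K : ℕ => (C * (2 * (K : ℝ) ^ (-p⁻¹) +
      A * (K : ℝ) ^ (-(p⁻¹ - 2⁻¹)) + D)) ^ p) atTop (nhds ((C * D) ^ p)) := by
    have := ((((hneg p⁻¹ (by positivity)).const_mul 2).add
      ((hneg (p⁻¹ - 2⁻¹) (by linarith)).const_mul A)).add_const D).const_mul C
    simpa using this.rpow_const (p := p) (Or.inr hp0.le)
  have hl : Tendsto (fun K : ℕ => B - (K : ℝ) ^ (-(1 : ℝ))) atTop (nhds B) := by
    simpa using (hneg 1 one_pos).const_sub B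
  refine le_of_tendsto_of_tendsto hl hr ?_
  filter_upwards [eventually_gt_atTop 0] with K hK
  have hK0 : (0 : ℝ) < K := by exact_mod_cast hK
  have h1 : C * (2 * (K : ℝ) ^ (-p⁻¹) + A * (K : ℝ) ^ (-(p⁻¹ - 2⁻¹)) + D) =
      C * (2 + A * (K : ℝ) ^ (2 : ℝ)⁻¹ + D * (K : ℝ) ^ p⁻¹) * (K : ℝ) ^ (-p⁻¹) := by
    rw [show -(p⁻¹ - 2⁻¹) = (2 : ℝ)⁻¹ + -p⁻¹ by ring, Real.rpow_add hK0]
    have : (K : ℝ) ^ p⁻¹ * (K : ℝ) ^ (-p⁻¹) = 1 := by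
      rw [← Real.rpow_add hK0, add_neg_cancel, Real.rpow_zero]
    linear_combination (-C * D) * this
  rw [h1, Real.mul_rpow (by positivity) (by positivity), ← Real.rpow_mul hK0.le,
    show -p⁻¹ * p = -1 by field_simp, Real.rpow_neg_one, ← div_eq_mul_inv, le_div_iff₀ hK0,
    sub_mul, inv_mul_cancel₀ hK0.ne', mul_comm B]
  exact h K hK

/-- Normalized weakly null sequences of `X` stay away from bounded subsets of `L_2(0,1)`. -/
lemma exists_pos_frequently_lt_norm_sub_inclLp (hp1 : 1 < p) (hp2 : p < 2)
    {X : Submodule ℝ (UnitLp p)}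
    {f : X → lp (fun _ : ℕ => ℝ) (ENNReal.ofReal p)} (hf : WeakSeqCont f) (hcoarse : Coarse f)
    {α β b : ℝ} (hb0 : 0 < b)
    (hb : ∀ x y : X, α ≤ ‖x - y‖ → ‖x - y‖ ≤ β → b ≤ ‖f x - f y‖) :
    ∃ δ, 0 < δ ∧ ∀ w : ℕ → X, (∀ n, α ≤ ‖w n‖) → (∀ n, ‖w n‖ ≤ β) →
      (∀ m, Tendsto (fun n => dyadicProj p m (w n)) atTop (nhds 0)) →
      ∀ (M : ℝ) (u : ℕ → UnitLp 2), (∀ n, ‖u n‖ ≤ M) →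
        ∃ᶠ n in atTop, δ < ‖(w n : UnitLp p) - inclLp hp2.le (u n)‖ := by
  have hp0 : 0 < p := by linarith
  obtain ⟨C, hC0, hC⟩ := hcoarse.exists_norm_sub_le
  refine ⟨b / (16 * (C + 1)), by positivity, fun w hwα hwβ hw M u hu => ?_⟩
  set δ := b / (16 * (C + 1)) with hδ
  have hδ0 : 0 < δ := by positivity
  have hM0 : 0 ≤ M := (norm_nonneg _).trans (hu 0)
  by_contra hcon
  simp only [Filter.not_frequently, not_lt] at hcon
  have key : b ^ p / 2 ≤ (C * (2 * (2 * δ) ^ p) ^ p⁻¹) ^ p := by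
    refine le_rpow_of_forall_nat_mul_le hp0 hp2 (A := (2 * (2 * M) ^ (2 : ℝ)) ^ (2 : ℝ)⁻¹)
      (by positivity) hC0 (by positivity) fun K hK => ?_
    have hK0 : (0 : ℝ) < K := by exact_mod_cast hK
    obtain ⟨m, s, U, V, -, -, hs, hU2, hVp, hfs⟩ := exists_sum_of_near_inclLp hp1 hp2.le hf hb0.le hb
      hwα hwβ hw hu hcon (inv_pos.2 hK0) K
    rw [mul_inv_cancel₀ hK0.ne'] at hs
    rw [mul_sub, mul_inv_cancel₀ hK0.ne'] at hfs
    rw [← Real.le_rpow_inv_iff_of_pos (norm_nonneg _) (by positivity) (by positivity),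
      Real.mul_rpow (by positivity) hK0.le] at hU2 hVp
    refine hfs.trans (Real.rpow_le_rpow (norm_nonneg _) ((hC s).trans ?_) hp0.le)
    refine mul_le_mul_of_nonneg_left ?_ hC0
    have h1 : (s : UnitLp p) = ((s : UnitLp p) - inclLp hp2.le U - V) + inclLp hp2.le U + V := by
      abel
    have h2 : ‖s‖ ≤ ‖(s : UnitLp p) - inclLp hp2.le U - V‖ + ‖inclLp hp2.le U‖ + ‖V‖ := by
      rw [Submodule.coe_norm]
      nth_rewrite 1 [h1]
      exact norm_add₃_le
    linarith [norm_inclLp_le hp2.le U]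
  have h1 : (C * (2 * (2 * δ) ^ p) ^ p⁻¹) ^ p = 2 * (2 * C * δ) ^ p := by
    rw [Real.mul_rpow hC0 (by positivity), ← Real.rpow_mul (by positivity),
      inv_mul_cancel₀ hp0.ne', Real.rpow_one, show 2 * C * δ = C * (2 * δ) by ring,
      Real.mul_rpow hC0 (by positivity)]
    ring
  have h2 : 2 * C * δ ≤ 1 / 8 * b := by
    have : δ * (16 * (C + 1)) = b := by rw [hδ]; field_simp
    linarith
  have h3 : (2 * C * δ) ^ p ≤ 1 / 8 * b ^ p := by
    refine (Real.rpow_le_rpow (by positivity) h2 hp0.le).trans ?_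
    rw [Real.mul_rpow (by norm_num) hb0.le]
    gcongr
    exact Real.rpow_le_self_of_le_one (by norm_num) (by norm_num) hp1.le
  have h4 : 0 < b ^ p := by positivity
  linarith

end StrongEmbedding

section AsymptoticConvexity

lemma exists_pos_rpow_le_rpow_add {p : ℝ} (hp : 0 < p) (R : ℝ) {ε : ℝ} (hε : 0 < ε) :
    ∃ τ, 0 < τ ∧ ∀ s t : ℝ, 0 ≤ s → s ≤ R → 0 ≤ t → s ≤ t + τ → s ^ p ≤ t ^ p + ε := by
  have huc : UniformContinuousOn (fun s : ℝ => s ^ p) (Set.Icc 0 R) :=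
    isCompact_Icc.uniformContinuousOn_of_continuous
      (Real.continuous_rpow_const hp.le).continuousOn
  obtain ⟨τ, hτ, h⟩ := Metric.uniformContinuousOn_iff.1 huc ε hε
  refine ⟨τ / 2, by positivity, fun s t hs hsR ht hst => ?_⟩
  rcases le_total s t with hle | hle
  · linarith [Real.rpow_le_rpow hs hle hp.le]
  · have := h s ⟨hs, hsR⟩ t ⟨ht, hle.trans hsR⟩ (by
      rw [Real.dist_eq, abs_of_nonneg (by linarith)]
      linarith)
    rw [Real.dist_eq] at this
    linarith [(abs_lt.1 this).2]

variable {p : ℝ}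

lemma exists_inclLp_truncation (hp2 : p ≤ 2) (w : UnitLp p) {M : ℝ} (hM : 0 ≤ M) :
    ∃ u : UnitLp 2, ‖u‖ ≤ M ∧ ∀ᵐ t ∂unitVolume, (w - inclLp hp2 u) t = 0 ∨
      M < |w t| ∧ (w - inclLp hp2 u) t = w t := by
  have hmeas : MeasurableSet {t | |w t| ≤ M} :=
    measurableSet_le (Lp.stronglyMeasurable w).measurable.abs measurable_const
  have hbound : ∀ t, ‖Set.indicator {t | |w t| ≤ M} w t‖ ≤ M := fun t => by
    by_cases ht : |w t| ≤ M
    · rwa [Set.indicator_of_mem (show t ∈ {t | |w t| ≤ M} from ht)]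
    · rwa [Set.indicator_of_notMem (show t ∉ {t | |w t| ≤ M} from ht), norm_zero]
  have hmem : MemLp (Set.indicator {t | |w t| ≤ M} w) (ENNReal.ofReal 2) unitVolume :=
    MemLp.of_bound ((Lp.aestronglyMeasurable w).indicator hmeas) M (ae_of_all _ hbound)
  refine ⟨hmem.toLp _, ?_, ?_⟩
  · have h := Lp.norm_le_of_ae_bound (f := hmem.toLp _) hM (by
      filter_upwards [hmem.coeFn_toLp] with t ht
      rw [ht]
      exact hbound t)
    simpa [measureUnivNNReal] using h
  · filter_upwards [Lp.coeFn_sub w (inclLp hp2 (hmem.toLp _)), hmem.coeFn_toLp] with t h1 h2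
    rw [h1, Pi.sub_apply, coeFn_inclLp, h2]
    by_cases ht : |w t| ≤ M
    · rw [Set.indicator_of_mem (show t ∈ {t | |w t| ≤ M} from ht), sub_self]
      exact Or.inl rfl
    · rw [Set.indicator_of_notMem (show t ∉ {t | |w t| ≤ M} from ht), sub_zero]
      exact Or.inr ⟨not_le.1 ht, rfl⟩

variable [Fact (1 ≤ ENNReal.ofReal p)]

lemma exists_forall_abs_dyadicProj_le (n : ℕ) (x : UnitLp p) :
    ∃ M, 0 ≤ M ∧ ∀ᵐ t ∂unitVolume, |dyadicProj p n x t| ≤ M := by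
  obtain ⟨M, hM, h⟩ := exists_forall_abs_comp_dyadicIndex_le n
    fun i => (unitVolume.real (dyadicCell n i))⁻¹ * ∫ s in dyadicCell n i, x s ∂unitVolume
  refine ⟨M, hM, ?_⟩
  filter_upwards [h, coeFn_dyadicProj n x] with t h1 h2
  rw [h2]
  exact h1

/-- The weakly null sequences of norm `α` in `X` stay at distance more than `δ` from bounded
sequences of `L_2(0,1)`. -/
def NullSequencesAvoidL2 (hp2 : p ≤ 2) (X : Submodule ℝ (UnitLp p)) (α δ : ℝ) : Prop :=
  ∀ w : ℕ → X, (∀ n, ‖w n‖ = α) →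
    (∀ m, Tendsto (fun n => dyadicProj p m (w n)) atTop (nhds 0)) →
    ∀ (M : ℝ) (u : ℕ → UnitLp 2), (∀ n, ‖u n‖ ≤ M) →
      ∃ᶠ n in atTop, δ < ‖(w n : UnitLp p) - inclLp hp2 (u n)‖

lemma NullSequencesAvoidL2.frequently_mul_lt {hp2 : p ≤ 2} {X : Submodule ℝ (UnitLp p)} {α δ : ℝ}
    (hα : 0 < α) (h : NullSequencesAvoidL2 hp2 X α δ) {w : ℕ → X} {τ : ℝ} (hτ : 0 < τ)
    (hwτ : ∀ n, τ ≤ ‖w n‖)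
    (hw : ∀ m, Tendsto (fun n => dyadicProj p m (w n)) atTop (nhds 0))
    {M : ℝ} {u : ℕ → UnitLp 2} (hu : ∀ n, ‖u n‖ ≤ M) :
    ∃ᶠ n in atTop, δ / α * ‖w n‖ < ‖(w n : UnitLp p) - inclLp hp2 (u n)‖ := by
  have hpos (n : ℕ) : 0 < ‖w n‖ := hτ.trans_le (hwτ n)
  have hsc (n : ℕ) : |α / ‖w n‖| ≤ α / τ := by
    rw [abs_of_pos (div_pos hα (hpos n))]
    gcongr
    exact hwτ n
  have hM0 : 0 ≤ M := (norm_nonneg _).trans (hu 0)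
  have hincl (c : ℝ) (v : UnitLp 2) : inclLp hp2 (c • v) = c • inclLp hp2 v := by
    refine Lp.ext ?_
    rw [coeFn_inclLp]
    exact (Lp.coeFn_smul c v).trans (Lp.coeFn_smul c (inclLp hp2 v)).symm
  refine (h (fun n => (α / ‖w n‖) • w n) (fun n => ?_) (fun m => ?_) (α / τ * M)
    (fun n => (α / ‖w n‖) • u n) (fun n => ?_)).mono fun n hn => ?_
  · rw [norm_smul, Real.norm_eq_abs, abs_of_pos (div_pos hα (hpos n)),
      div_mul_cancel₀ _ (hpos n).ne']
  · refine squeeze_zero_norm (a := fun n => α / τ * ‖dyadicProj p m (w n)‖) (fun n => ?_) ?_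
    · rw [Submodule.coe_smul, map_smul, norm_smul]
      gcongr
      exact hsc n
    · simpa using (hw m).norm.const_mul (α / τ)
  · rw [norm_smul]
    gcongr
    · exact hsc n
    · exact hu n
  · rw [hincl, Submodule.coe_smul, ← smul_sub, norm_smul, Real.norm_eq_abs,
      abs_of_pos (div_pos hα (hpos n)), div_mul_eq_mul_div, lt_div_iff₀ (hpos n)] at hn
    rw [div_mul_eq_mul_div, div_lt_iff₀ hα, mul_comm _ α]
    exact hn

lemma exists_pos_frequently_add_mul_le (hp1 : 1 < p) (hp2 : p ≤ 2) {X : Submodule ℝ (UnitLp p)}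
    {α δ : ℝ} (hα : 0 < α) (hδ : 0 < δ) (hX : NullSequencesAvoidL2 hp2 X α δ) :
    ∃ c, 0 < c ∧ ∀ (x : UnitLp p) (w : ℕ → X) (τ B : ℝ), 0 < τ → (∀ n, τ ≤ ‖w n‖) →
      (∀ n, ‖w n‖ ≤ B) → (∀ m, Tendsto (fun n => dyadicProj p m (w n)) atTop (nhds 0)) →
      ∀ ε, 0 < ε → ∃ᶠ n in atTop, ‖x‖ ^ p + c * ‖w n‖ ^ p ≤ ‖x + w n‖ ^ p + ε := by
  have hp0 : 0 < p := by linarith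
  obtain ⟨C, hC, hdef⟩ := exists_abs_rpow_le_convexityDefect hp1 one_half_pos
  refine ⟨C⁻¹ * (δ / α) ^ p, by positivity, fun x w τ B hτ hwτ hwB hw ε hε => ?_⟩
  have hB0 : 0 ≤ B := (norm_nonneg _).trans (hwB 0)
  have hε' : 0 < ε / (2 + C⁻¹) := by positivity
  obtain ⟨σ, hσ, hpow⟩ := exists_pos_rpow_le_rpow_add hp0 (‖x‖ + (1 + δ / α) * B + ‖x‖ + B) hε'
  obtain ⟨k, hk⟩ : ∃ k, ‖x - dyadicProj p k x‖ < σ / 2 := by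
    have h := ((tendsto_dyadicProj x).const_sub x).norm
    rw [sub_self, norm_zero] at h
    exact (h.eventually_lt_const (by positivity)).exists
  obtain ⟨M, hM, hxM⟩ := exists_forall_abs_dyadicProj_le k x
  choose u huM hu using fun n => exists_inclLp_truncation hp2
    ((w n : UnitLp p) - dyadicProj p k (w n)) hM
  have hsmall : ∀ᶠ n in atTop, ‖dyadicProj p k (w n)‖ < σ / 2 := by
    have h := (hw k).norm
    rw [norm_zero] at h
    exact h.eventually_lt_const (by positivity)
  refine ((hX.frequently_mul_lt hα hτ hwτ hw huM).and_eventually hsmall).mono fun n hn => ?_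
  obtain ⟨hfar, hnk⟩ := hn
  set x' := dyadicProj p k x with hx'
  set w' := (w n : UnitLp p) - dyadicProj p k (w n) with hw'
  set v := w' - inclLp hp2 (u n) with hv
  have hv1 : ‖v‖ ^ p ≤ 0 * ‖x'‖ ^ p + 2 * C / 2 * (‖x' + w'‖ ^ p - ‖x'‖ ^ p) := by
    refine norm_rpow_le_of_ae_le_convexityDefect hp1 (m := k)
      (dyadicProj_dyadicProj_of_ge le_rfl x)
      (by rw [hw', map_sub, dyadicProj_dyadicProj_of_ge le_rfl, sub_self]) (by positivity) ?_
    filter_upwards [hu n, hxM] with t ht hxt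
    have hnn := convexityDefect_nonneg hp1 (x' t) (w' t)
    rcases ht with ht | ⟨hMt, ht⟩
    · rw [ht, abs_zero, Real.zero_rpow hp0.ne']
      positivity
    · rw [ht]
      have h1 := hdef (x' t) (w' t)
      have h2 : |x' t| ^ p ≤ |w' t| ^ p :=
        Real.rpow_le_rpow (abs_nonneg _) (hxt.trans hMt.le) hp0.le
      linarith
  have hv2 : C⁻¹ * ‖v‖ ^ p ≤ ‖x' + w'‖ ^ p - ‖x'‖ ^ p := by
    rw [inv_mul_le_iff₀ hC]
    linarith
  have hw'B : ‖w'‖ ≤ B + B := (norm_sub_le _ _).trans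
    (add_le_add (hwB n) ((norm_dyadicProj_le _ _).trans (hwB n)))
  have hδα : 0 < δ / α := div_pos hδ hα
  have h1 : ‖x‖ ^ p ≤ ‖x'‖ ^ p + ε / (2 + C⁻¹) := by
    refine hpow _ _ (norm_nonneg _) ?_ (norm_nonneg _) ?_
    · have : 0 ≤ (1 + δ / α) * B := by positivity
      linarith [norm_nonneg x]
    · linarith [norm_le_norm_add_norm_sub' x x']
  have h2 : (δ / α * ‖w n‖) ^ p ≤ ‖v‖ ^ p + ε / (2 + C⁻¹) := by
    refine hpow _ _ (by positivity) ?_ (norm_nonneg _) ?_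
    · have : δ / α * ‖w n‖ ≤ δ / α * B := by gcongr; exact hwB n
      linarith [norm_nonneg x]
    · have : (w n : UnitLp p) - inclLp hp2 (u n) = v + dyadicProj p k (w n) := by
        rw [hv, hw']; abel
      rw [this] at hfar
      linarith [norm_add_le v (dyadicProj p k (w n))]
  have h3 : ‖x' + w'‖ ^ p ≤ ‖x + w n‖ ^ p + ε / (2 + C⁻¹) := by
    refine hpow _ _ (norm_nonneg _) ?_ (norm_nonneg _) ?_
    · have h0 : 0 ≤ δ / α * B := by positivity
      linarith [norm_add_le x' w', norm_dyadicProj_le k x, norm_nonneg x]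
    · have : x' + w' = (x + w n) - ((x - x') + dyadicProj p k (w n)) := by
        rw [hw']; abel
      rw [this]
      linarith [norm_sub_le (x + (w n : UnitLp p)) ((x - x') + dyadicProj p k (w n)),
        norm_add_le (x - x') (dyadicProj p k (w n))]
  rw [Real.mul_rpow hδα.le (norm_nonneg _)] at h2
  have h4 : C⁻¹ * ((δ / α) ^ p * ‖w n‖ ^ p) ≤ C⁻¹ * (‖v‖ ^ p + ε / (2 + C⁻¹)) := by gcongr
  have h5 : (2 + C⁻¹) * (ε / (2 + C⁻¹)) = ε := by field_simp
  rw [mul_assoc]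
  linarith

/-- An asymptotic lower `p`-estimate for the sequences that are asymptotically in `X`. -/
lemma exists_pos_frequently_add_mul_norm_sub_le (hp1 : 1 < p) (hp2 : p ≤ 2)
    {X : Submodule ℝ (UnitLp p)} {α δ : ℝ} (hα : 0 < α) (hδ : 0 < δ)
    (hX : NullSequencesAvoidL2 hp2 X α δ) :
    ∃ c, 0 < c ∧ ∀ (x : X) (y : ℕ → UnitLp p) (z : ℕ → X) (B : ℝ), (∀ n, ‖y n‖ ≤ B) →
      Tendsto (fun n => y n - z n) atTop (nhds 0) →
      (∀ m, Tendsto (fun n => dyadicProj p m (y n)) atTop (nhds (dyadicProj p m x))) →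
      ∀ ε, 0 < ε → ∃ᶠ n in atTop, ‖x‖ ^ p + c * ‖y n - x‖ ^ p ≤ ‖y n‖ ^ p + ε := by
  have hp0 : 0 < p := by linarith
  obtain ⟨c, hc, h⟩ := exists_pos_frequently_add_mul_le hp1 hp2 hα hδ hX
  refine ⟨c, hc, fun x y z B hB hyz hy ε hε => ?_⟩
  have hB0 : 0 ≤ B := (norm_nonneg _).trans (hB 0)
  have hyz' := hyz.norm
  rw [norm_zero] at hyz'
  have hε' : 0 < ε / (2 + c) := by positivity
  have hε3 : (2 + c) * (ε / (2 + c)) = ε := by field_simp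
  obtain ⟨σ, hσ, hpow⟩ := exists_pos_rpow_le_rpow_add hp0 (‖x‖ + B + 1) hε'
  have hcoe : ‖(x : UnitLp p)‖ = ‖x‖ := rfl
  by_cases hτ : ∃ τ, 0 < τ ∧ ∀ᶠ n in atTop, τ ≤ ‖z n - x‖
  · obtain ⟨τ, hτ, hev⟩ := hτ
    obtain ⟨N, hN⟩ := eventually_atTop.1 (hev.and (hyz'.eventually_lt_const
      (show 0 < min σ 1 by positivity)))
    have hb (n : ℕ) : ‖z (n + N) - x‖ ≤ B + 1 + ‖x‖ := by
      have h1 := (hN (n + N) (by omega)).2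
      have h2 : ((z (n + N) - x : X) : UnitLp p) =
        y (n + N) - (y (n + N) - z (n + N)) - x := by push_cast; abel
      rw [Submodule.coe_norm, h2]
      linarith [norm_sub_le (y (n + N) - (y (n + N) - z (n + N))) (x : UnitLp p),
        norm_sub_le (y (n + N)) (y (n + N) - z (n + N)), hB (n + N), min_le_right σ 1]
    have hz (m : ℕ) : Tendsto (fun n => dyadicProj p m ((z (n + N) - x : X) : UnitLp p)) atTop
        (nhds 0) := by
      have h1 := (((hy m).sub (((dyadicProj p m).continuous.tendsto _).comp hyz)).sub_const
        (dyadicProj p m x)).comp (tendsto_add_atTop_nat N)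
      simpa [Function.comp_def] using h1
    have hfr := h x (fun n => z (n + N) - x) τ _ hτ (fun n => (hN (n + N) (by omega)).1) hb hz _ hε'
    refine (tendsto_add_atTop_nat N).frequently (hfr.mono fun n hn => ?_)
    have hn1 := (hN (n + N) (by omega)).2
    have hn2 : ‖y (n + N) - z (n + N)‖ < σ := hn1.trans_le (min_le_left _ _)
    have hn3 : ‖y (n + N) - z (n + N)‖ < 1 := hn1.trans_le (min_le_right _ _)
    rw [Submodule.coe_sub, add_sub_cancel, hcoe] at hn
    have h1 : ‖y (n + N) - x‖ ^ p ≤ ‖z (n + N) - x‖ ^ p + ε / (2 + c) := by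
      refine hpow _ _ (norm_nonneg _) ?_ (norm_nonneg _) ?_
      · linarith [norm_sub_le (y (n + N)) (x : UnitLp p), hB (n + N)]
      · have : y (n + N) - (x : UnitLp p) = ((z (n + N) - x : X) : UnitLp p) +
          (y (n + N) - z (n + N)) := by push_cast; abel
        rw [this]
        refine (norm_add_le _ _).trans ?_
        rw [← Submodule.coe_norm]
        linarith
    have h2 : ‖(z (n + N) : UnitLp p)‖ ^ p ≤ ‖y (n + N)‖ ^ p + ε / (2 + c) := by
      have := norm_le_norm_add_norm_sub (y (n + N)) (z (n + N) : UnitLp p)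
      refine hpow _ _ (norm_nonneg _) ?_ (norm_nonneg _) ?_
      · linarith [norm_nonneg x, hB (n + N)]
      · linarith
    have h3 : c * ‖y (n + N) - x‖ ^ p ≤ c * (‖z (n + N) - x‖ ^ p + ε / (2 + c)) := by gcongr
    linarith
  · push Not at hτ
    have hfr := hτ (min σ 1 / 2) (by positivity)
    refine (hfr.and_eventually (hyz'.eventually_lt_const
      (show 0 < min σ 1 / 2 by positivity))).mono fun n hn => ?_
    obtain ⟨hn1, hn2⟩ := hn
    have hyx : ‖y n - x‖ < min σ 1 := by
      have : y n - (x : UnitLp p) = ((z n - x : X) : UnitLp p) + (y n - z n) := by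
        push_cast; abel
      rw [this]
      refine (norm_add_le _ _).trans_lt ?_
      rw [← Submodule.coe_norm]
      linarith
    have h1 : ‖x‖ ^ p ≤ ‖y n‖ ^ p + ε / (2 + c) := by
      refine hpow _ _ (norm_nonneg _) (by linarith) (norm_nonneg _) ?_
      rw [← hcoe]
      linarith [norm_le_norm_add_norm_sub (y n) (x : UnitLp p), min_le_left σ 1]
    have h2 : ‖y n - x‖ ^ p ≤ 0 ^ p + ε / (2 + c) := by
      refine hpow _ _ (norm_nonneg _) ?_ le_rfl ?_
      · linarith [norm_nonneg x, min_le_right σ 1]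
      · linarith [min_le_left σ 1]
    rw [Real.zero_rpow hp0.ne', zero_add] at h2
    have h3 : c * ‖y n - x‖ ^ p ≤ c * (ε / (2 + c)) := by gcongr
    linarith

end AsymptoticConvexity

section BlockDecomposition

variable {p : ℝ} [Fact (1 ≤ ENNReal.ofReal p)]

/-- Sequences of `L_p(0,1)` that are asymptotically in `X` satisfy an asymptotic lower `p`-estimate
with constant `c`. -/
def AsymptoticLowerEstimate (X : Submodule ℝ (UnitLp p)) (c : ℝ) : Prop :=
  ∀ (x : X) (y : ℕ → UnitLp p) (z : ℕ → X) (B : ℝ), (∀ n, ‖y n‖ ≤ B) →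
    Tendsto (fun n => y n - z n) atTop (nhds 0) →
    (∀ m, Tendsto (fun n => dyadicProj p m (y n)) atTop (nhds (dyadicProj p m x))) →
    ∀ ε, 0 < ε → ∃ᶠ n in atTop, ‖x‖ ^ p + c * ‖y n - x‖ ^ p ≤ ‖y n‖ ^ p + ε

lemma AsymptoticLowerEstimate.exists_lt_forall_exists_mem_Ico (hp1 : 1 < p) (hp2 : p ≤ 2)
    {X : Submodule ℝ (UnitLp p)} (hXc : IsClosed (X : Set (UnitLp p))) {c : ℝ} (hc : 0 < c)
    (hX : AsymptoticLowerEstimate X c) (m : ℕ) {ε : ℝ} (hε : 0 < ε) :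
    ∃ m', m < m' ∧ ∀ x ∈ X, ‖x‖ ≤ 1 → ∃ j, m ≤ j ∧ j < m' ∧
      (∃ y ∈ X, ‖dyadicProj p j x - y‖ < ε) ∧
      ∀ l, m' ≤ l → (∃ y ∈ X, ‖dyadicProj p l x - y‖ ≤ 1 / ((m' : ℝ) + 1)) →
        ‖dyadicProj p j x‖ ^ p + c * ‖dyadicProj p l x - dyadicProj p j x‖ ^ p ≤
          ‖dyadicProj p l x‖ ^ p + ε := by
  have hp0 : 0 < p := by linarith
  by_contra hcon
  push Not at hcon
  choose x hxX hx1 hx using fun n : ℕ => hcon (m + 1 + n) (by omega)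
  obtain ⟨z, σ, hσ, hz1, hz⟩ := exists_subseq_tendsto_dyadicProj hp1 hx1
  have hzX : z ∈ X := mem_of_tendsto_dyadicProj hp1 hp2 hXc (fun n => hxX (σ n))
    (fun n => hx1 (σ n)) hz
  have hε' : 0 < ε / (2 + c) := by positivity
  have hε3 : (2 + c) * (ε / (2 + c)) = ε := by field_simp
  obtain ⟨τ, hτ, hpow⟩ := exists_pos_rpow_le_rpow_add hp0 2 hε'
  obtain ⟨j, hmj, hj⟩ : ∃ j, m ≤ j ∧ ‖dyadicProj p j z - z‖ < min τ ε := by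
    have h := ((tendsto_dyadicProj z).sub_const z).norm
    rw [sub_self, norm_zero] at h
    exact ((eventually_ge_atTop m).and (h.eventually_lt_const (by positivity))).exists
  have hjlim : Tendsto (fun n => ‖dyadicProj p j (x (σ n)) - z‖) atTop
      (nhds ‖dyadicProj p j z - z‖) := ((hz j).sub_const z).norm
  obtain ⟨N, hN⟩ := eventually_atTop.1
    ((hjlim.eventually_lt_const hj).and (eventually_gt_atTop j))
  have hclose (n : ℕ) : ‖dyadicProj p j (x (σ (n + N))) - z‖ < min τ ε :=
    (hN (n + N) (by omega)).1
  choose l hl hy hlt using fun n : ℕ => hx (σ (n + N)) j hmj (by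
    have h1 := (hN (n + N) (by omega)).2
    have h2 := hσ.le_apply (x := n + N)
    omega) ⟨z, hzX, (hclose n).trans_le (min_le_right _ _)⟩
  choose y hyX hly using hy
  have hnl (n : ℕ) : n ≤ l n := by
    have h1 := hl n
    have h2 := hσ.le_apply (x := n + N)
    omega
  have hbound (n : ℕ) : ‖dyadicProj p (l n) (x (σ (n + N)))‖ ≤ 1 :=
    (norm_dyadicProj_le _ _).trans (hx1 _)
  obtain ⟨n, hn⟩ := (hX ⟨z, hzX⟩ (fun n => dyadicProj p (l n) (x (σ (n + N))))
    (fun n => ⟨y n, hyX n⟩) 1 hbound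
    (squeeze_zero_norm (a := fun n : ℕ => 1 / ((n : ℝ) + 1)) (fun n => (hly n).trans (by
      have h2 := hσ.le_apply (x := n + N)
      gcongr
      omega)) tendsto_one_div_add_atTop_nhds_zero_nat)
    (fun k => ((hz k).comp (tendsto_add_atTop_nat N)).congr' (by
      filter_upwards [eventually_ge_atTop k] with n hn
      exact (dyadicProj_dyadicProj_of_le (hn.trans (hnl n)) _).symm)) _ hε').exists
  have hn' : ‖z‖ ^ p + c * ‖dyadicProj p (l n) (x (σ (n + N))) - z‖ ^ p ≤
    ‖dyadicProj p (l n) (x (σ (n + N)))‖ ^ p + ε / (2 + c) := hn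
  have hτn := (hclose n).trans_le (min_le_left τ ε)
  have hj1 : ‖dyadicProj p j (x (σ (n + N)))‖ ≤ 1 := (norm_dyadicProj_le _ _).trans (hx1 _)
  have h1 : ‖dyadicProj p j (x (σ (n + N)))‖ ^ p ≤ ‖z‖ ^ p + ε / (2 + c) :=
    hpow _ _ (norm_nonneg _) (by linarith) (norm_nonneg _)
      (by linarith [norm_le_norm_add_norm_sub' (dyadicProj p j (x (σ (n + N)))) z])
  have h2 : ‖dyadicProj p (l n) (x (σ (n + N))) - dyadicProj p j (x (σ (n + N)))‖ ^ p ≤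
      ‖dyadicProj p (l n) (x (σ (n + N))) - z‖ ^ p + ε / (2 + c) := by
    refine hpow _ _ (norm_nonneg _) ?_ (norm_nonneg _) ?_
    · linarith [norm_sub_le (dyadicProj p (l n) (x (σ (n + N)))) (dyadicProj p j (x (σ (n + N)))),
        hbound n]
    · have := norm_sub_le_norm_sub_add_norm_sub (dyadicProj p (l n) (x (σ (n + N)))) z
        (dyadicProj p j (x (σ (n + N))))
      rw [norm_sub_rev z] at this
      linarith
  have h3 : c * ‖dyadicProj p (l n) (x (σ (n + N))) - dyadicProj p j (x (σ (n + N)))‖ ^ p ≤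
      c * (‖dyadicProj p (l n) (x (σ (n + N))) - z‖ ^ p + ε / (2 + c)) := by gcongr
  linarith [hlt n]

lemma norm_add_rpow_le {E : Type*} [SeminormedAddCommGroup E] {p : ℝ} (hp1 : 1 ≤ p) (hp2 : p ≤ 2)
    (a b : E) : ‖a + b‖ ^ p ≤ 2 * ‖a‖ ^ p + 2 * ‖b‖ ^ p := by
  have h := abs_add_rpow_add_abs_sub_rpow_le hp1 hp2 ‖a‖ ‖b‖
  have h0 : 0 ≤ |‖a‖ - ‖b‖| ^ p := by positivity
  rw [abs_of_nonneg (by positivity : 0 ≤ ‖a‖ + ‖b‖), abs_norm, abs_norm] at h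
  have h1 : ‖a + b‖ ^ p ≤ (‖a‖ + ‖b‖) ^ p :=
    Real.rpow_le_rpow (norm_nonneg _) (norm_add_le a b) (by linarith)
  linarith

lemma norm_dyadicProj_sub_dyadicProj_rpow_le (hp1 : 1 ≤ p) (hp2 : p ≤ 2) {i₀ m i₁ n i₂ : ℕ}
    (h₀ : i₀ ≤ m) (hmn : m ≤ n) (h₂ : n ≤ i₂) (x : UnitLp p) :
    ‖dyadicProj p n x - dyadicProj p m x‖ ^ p ≤ 2 ^ p *
      (2 * ‖dyadicProj p i₂ x - dyadicProj p i₁ x‖ ^ p +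
        2 * ‖dyadicProj p i₁ x - dyadicProj p i₀ x‖ ^ p) := by
  have hp0 : 0 ≤ p := by linarith
  have h : dyadicProj p n x - dyadicProj p m x =
      dyadicProj p n (dyadicProj p i₂ x - dyadicProj p i₀ x) -
        dyadicProj p m (dyadicProj p i₂ x - dyadicProj p i₀ x) := by
    rw [map_sub, map_sub, dyadicProj_dyadicProj_of_le h₂,
      dyadicProj_dyadicProj_of_le (hmn.trans h₂), dyadicProj_dyadicProj_of_ge h₀,
      dyadicProj_dyadicProj_of_ge (h₀.trans hmn), sub_sub_sub_cancel_right]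
  calc ‖dyadicProj p n x - dyadicProj p m x‖ ^ p
      ≤ (2 * ‖dyadicProj p i₂ x - dyadicProj p i₀ x‖) ^ p := by
        rw [h]
        exact Real.rpow_le_rpow (norm_nonneg _) (norm_dyadicProj_sub_le _) hp0
    _ = 2 ^ p * ‖(dyadicProj p i₂ x - dyadicProj p i₁ x) +
          (dyadicProj p i₁ x - dyadicProj p i₀ x)‖ ^ p := by
        rw [Real.mul_rpow zero_le_two (norm_nonneg _), sub_add_sub_cancel]
    _ ≤ _ := by
        gcongr
        exact norm_add_rpow_le hp1 hp2 _ _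

/-- The unit ball of `X` admits a uniform upper `p`-estimate for suitable blocks of conditional
expectations. -/
lemma AsymptoticLowerEstimate.exists_strictMono_sum_le (hp1 : 1 < p) (hp2 : p ≤ 2)
    {X : Submodule ℝ (UnitLp p)} (hXc : IsClosed (X : Set (UnitLp p))) {c : ℝ} (hc : 0 < c)
    (hX : AsymptoticLowerEstimate X c) :
    ∃ (m : ℕ → ℕ) (D : ℝ), StrictMono m ∧ 0 ≤ D ∧ ∀ x ∈ X, ‖x‖ ≤ 1 → ∀ N,
      ∑ k ∈ Finset.range N, ‖dyadicProj p (m (k + 1)) x - dyadicProj p (m k) x‖ ^ p ≤ D := by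
  have hp0 : 0 < p := by linarith
  choose F hF hFx using fun m i : ℕ => hX.exists_lt_forall_exists_mem_Ico hp1 hp2 hXc hc m
    (show 0 < min ((1 / 2 : ℝ) ^ i) (1 / ((m : ℝ) + 1)) by positivity)
  obtain ⟨m, hm1⟩ : ∃ m : ℕ → ℕ, ∀ i, m (i + 1) = F (m i) i :=
    ⟨fun n => Nat.rec 0 (fun i r => F r i) n, fun _ => rfl⟩
  have hmono : StrictMono m := strictMono_nat_of_lt_succ fun i => by
    rw [hm1]
    exact hF _ _
  refine ⟨fun k => m (k + 1), 2 ^ p * (2 * (3 / c) + 2 * (3 / c)),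
    fun a b hab => hmono (Nat.succ_lt_succ hab), by positivity, fun x hxX hx1 N => ?_⟩
  replace hFx := fun i : ℕ => hFx (m i) i x hxX hx1
  simp only [← hm1] at hFx
  choose j hj1 hj2 hjX hj using hFx
  have hstep (i : ℕ) : ‖dyadicProj p (j i) x‖ ^ p +
      c * ‖dyadicProj p (j (i + 1)) x - dyadicProj p (j i) x‖ ^ p ≤
        ‖dyadicProj p (j (i + 1)) x‖ ^ p + (1 / 2 : ℝ) ^ i := by
    obtain ⟨y, hyX, hy⟩ := hjX (i + 1)
    have h1 := hj i (j (i + 1)) (hj1 (i + 1)) ⟨y, hyX, hy.le.trans (min_le_right _ _)⟩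
    exact h1.trans (by gcongr; exact min_le_left _ _)
  have hsum (N : ℕ) : ∑ i ∈ Finset.range N,
      ‖dyadicProj p (j (i + 1)) x - dyadicProj p (j i) x‖ ^ p ≤ 3 / c := by
    have h1 : c * ∑ i ∈ Finset.range N,
        ‖dyadicProj p (j (i + 1)) x - dyadicProj p (j i) x‖ ^ p ≤
        ∑ i ∈ Finset.range N, ((‖dyadicProj p (j (i + 1)) x‖ ^ p - ‖dyadicProj p (j i) x‖ ^ p) +
          (1 / 2 : ℝ) ^ i) := by
      rw [Finset.mul_sum]
      exact Finset.sum_le_sum fun i _ => by linarith [hstep i]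
    rw [Finset.sum_add_distrib,
      Finset.sum_range_sub (fun i => ‖dyadicProj p (j i) x‖ ^ p)] at h1
    have h2 : ‖dyadicProj p (j N) x‖ ^ p ≤ 1 :=
      Real.rpow_le_one (norm_nonneg _) ((norm_dyadicProj_le _ _).trans hx1) hp0.le
    have h3 : 0 ≤ ‖dyadicProj p (j 0) x‖ ^ p := by positivity
    have h4 := sum_geometric_two_le N
    rw [le_div_iff₀ hc]
    linarith
  calc ∑ k ∈ Finset.range N, ‖dyadicProj p (m (k + 1 + 1)) x - dyadicProj p (m (k + 1)) x‖ ^ p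
      ≤ ∑ k ∈ Finset.range N, 2 ^ p *
        (2 * ‖dyadicProj p (j (k + 1 + 1)) x - dyadicProj p (j (k + 1)) x‖ ^ p +
          2 * ‖dyadicProj p (j (k + 1)) x - dyadicProj p (j k) x‖ ^ p) :=
        Finset.sum_le_sum fun k _ => norm_dyadicProj_sub_dyadicProj_rpow_le hp1.le hp2
          (hj2 k).le (hmono (Nat.lt_succ_self _)).le (hj1 _) x
    _ = 2 ^ p * (2 * ∑ k ∈ Finset.range N,
          ‖dyadicProj p (j (k + 1 + 1)) x - dyadicProj p (j (k + 1)) x‖ ^ p +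
        2 * ∑ k ∈ Finset.range N,
          ‖dyadicProj p (j (k + 1)) x - dyadicProj p (j k) x‖ ^ p) := by
        rw [Finset.mul_sum, Finset.mul_sum, ← Finset.sum_add_distrib, Finset.mul_sum]
    _ ≤ _ := by
        gcongr
        · have h := hsum (N + 1)
          rw [Finset.sum_range_succ'] at h
          have : 0 ≤ ‖dyadicProj p (j (0 + 1)) x - dyadicProj p (j 0) x‖ ^ p := by positivity
          linarith
        · exact hsum N

end BlockDecomposition

section BlockEmbedding

variable {p : ℝ} [Fact (1 ≤ ENNReal.ofReal p)]

/-- The block of dyadic martingale differences between the generations `m (k - 1)` and `m k`. -/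
noncomputable def dyadicBlock (p : ℝ) [Fact (1 ≤ ENNReal.ofReal p)] (m : ℕ → ℕ) :
    ℕ → UnitLp p →L[ℝ] UnitLp p
  | 0 => dyadicProj p (m 0)
  | k + 1 => dyadicProj p (m (k + 1)) - dyadicProj p (m k)

lemma dyadicProj_dyadicBlock {m : ℕ → ℕ} (hm : StrictMono m) (k : ℕ) (x : UnitLp p) :
    dyadicProj p (m k) (dyadicBlock p m k x) = dyadicBlock p m k x := by
  cases k with
  | zero => exact dyadicProj_dyadicProj_of_ge le_rfl x
  | succ k =>
    rw [dyadicBlock, sub_apply, map_sub, dyadicProj_dyadicProj_of_ge le_rfl,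
      dyadicProj_dyadicProj_of_ge (hm k.lt_succ_self).le]

lemma norm_dyadicProj_rpow_le_sum (hp1 : 1 ≤ p) (hp2 : p ≤ 2) {m : ℕ → ℕ} (hm : StrictMono m)
    (N : ℕ) (x : UnitLp p) :
    ‖dyadicProj p (m N) x‖ ^ p ≤ 2 * ∑ k ∈ Finset.range (N + 1), ‖dyadicBlock p m k x‖ ^ p := by
  induction N with
  | zero =>
    have : 0 ≤ ‖dyadicProj p (m 0) x‖ ^ p := by positivity
    simp only [zero_add, Finset.sum_range_one, dyadicBlock]
    linarith
  | succ N ih =>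
    have h := (hm N.lt_succ_self).le
    have h1 := norm_add_rpow_le_of_dyadicProj hp1 hp2
      (dyadicProj_dyadicProj_of_ge le_rfl x) (dyadicProj_dyadicProj_sub h x)
    rw [add_sub_cancel] at h1
    rw [Finset.sum_range_succ, mul_add]
    exact h1.trans (by gcongr; rfl)

/-- The coordinates, in the normalized indicators of dyadic intervals, of the blocks. -/
noncomputable def blockCoord (p : ℝ) [Fact (1 ≤ ENNReal.ofReal p)] (m : ℕ → ℕ) (q : ℕ × ℕ) :
    UnitLp p →L[ℝ] ℝ :=
  if q.2 < 2 ^ m q.1 then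
    unitVolume.real (dyadicCell (m q.1) q.2) ^ (p⁻¹ - 1) •
      (cellIntegral p (m q.1) q.2).comp (dyadicBlock p m q.1)
  else 0

lemma hasSum_abs_blockCoord_rpow (hp : 0 < p) {m : ℕ → ℕ} (hm : StrictMono m) (k : ℕ)
    (x : UnitLp p) :
    HasSum (fun i => |blockCoord p m (k, i) x| ^ p) (‖dyadicBlock p m k x‖ ^ p) := by
  rw [← dyadicProj_dyadicBlock hm k x, norm_dyadicProj_rpow hp]
  have h : ∑ i ∈ Finset.range (2 ^ m k),
      |unitVolume.real (dyadicCell (m k) i) ^ (p⁻¹ - 1) *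
        cellIntegral p (m k) i (dyadicBlock p m k x)| ^ p =
      ∑ i ∈ Finset.range (2 ^ m k), |blockCoord p m (k, i) x| ^ p := by
    refine Finset.sum_congr rfl fun i hi => ?_
    rw [blockCoord, if_pos (by simpa using hi)]
    rfl
  rw [h]
  refine hasSum_sum_of_ne_finset_zero fun i hi => ?_
  rw [blockCoord, if_neg (by simpa using hi), zero_apply, abs_zero,
    Real.zero_rpow hp.ne']

lemma hasSum_abs_blockCoord_unpair_rpow (hp : 0 < p) {m : ℕ → ℕ} (hm : StrictMono m)
    {x : UnitLp p} (hx : Summable fun k => ‖dyadicBlock p m k x‖ ^ p) :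
    HasSum (fun n : ℕ => |blockCoord p m n.unpair x| ^ p) (∑' k, ‖dyadicBlock p m k x‖ ^ p) := by
  have hk (k : ℕ) := hasSum_abs_blockCoord_rpow hp hm k x
  have hs : Summable fun q : ℕ × ℕ => |blockCoord p m q x| ^ p := by
    refine (summable_prod_of_nonneg fun q => by positivity).2 ⟨fun k => (hk k).summable, ?_⟩
    simpa only [(hk _).tsum_eq] using hx
  have h := hs.hasSum
  rw [← (h.prod_fiberwise hk).tsum_eq] at h
  exact (Nat.pairEquiv.symm.hasSum_iff (f := fun q : ℕ × ℕ => |blockCoord p m q x| ^ p)).2 h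

/-- A subspace on which the blocks satisfy an upper `p`-estimate embeds in `ℓ_p`. -/
lemma exists_embedding_of_sum_dyadicBlock_le (hp1 : 1 ≤ p) (hp2 : p ≤ 2)
    {X : Submodule ℝ (UnitLp p)} {m : ℕ → ℕ} (hm : StrictMono m) {D : ℝ} (hD : 0 ≤ D)
    (hX : ∀ x ∈ X, ∀ N, ∑ k ∈ Finset.range N, ‖dyadicBlock p m k x‖ ^ p ≤ D * ‖x‖ ^ p) :
    ∃ (T : X →L[ℝ] lp (fun _ : ℕ => ℝ) (ENNReal.ofReal p)) (c C : ℝ),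
      0 < c ∧ c ≤ C ∧ ∀ x : X, c * ‖x‖ ≤ ‖T x‖ ∧ ‖T x‖ ≤ C * ‖x‖ := by
  have hp0 : 0 < p := by linarith
  have hsum (x : X) : Summable fun k => ‖dyadicBlock p m k x‖ ^ p :=
    summable_of_sum_range_le (fun k => by positivity) (hX x x.2)
  have hcoord (x : X) := hasSum_abs_blockCoord_unpair_rpow hp0 hm (hsum x)
  have hmem (x : X) : Memℓp (fun n : ℕ => blockCoord p m n.unpair x) (ENNReal.ofReal p) := by
    refine memℓp_gen ?_
    simpa only [ENNReal.toReal_ofReal hp0.le, Real.norm_eq_abs] using (hcoord x).summable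
  set L : X →ₗ[ℝ] lp (fun _ : ℕ => ℝ) (ENNReal.ofReal p) :=
    { toFun := fun x => ⟨fun n => blockCoord p m n.unpair x, hmem x⟩
      map_add' := fun x y => by
        ext n
        exact map_add (blockCoord p m n.unpair) (x : UnitLp p) y
      map_smul' := fun a x => by
        ext n
        exact map_smul (blockCoord p m n.unpair) a (x : UnitLp p) } with hL
  have hnorm (x : X) : ‖L x‖ ^ p = ∑' k, ‖dyadicBlock p m k x‖ ^ p :=
    (lp_hasSum_abs_rpow hp0 (L x)).unique (hcoord x)
  have hupper (x : X) : ‖L x‖ ≤ (D ^ p⁻¹ + 1) * ‖x‖ := by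
    have h1 : ‖L x‖ ^ p ≤ D * ‖x‖ ^ p := by
      rw [hnorm]
      exact Real.tsum_le_of_sum_range_le (fun k => by positivity) (hX x x.2)
    rw [← Real.le_rpow_inv_iff_of_pos (norm_nonneg _) (by positivity) hp0,
      Real.mul_rpow hD (by positivity), Real.rpow_rpow_inv (norm_nonneg _) hp0.ne'] at h1
    linarith [norm_nonneg x]
  have hlower (x : X) : ‖x‖ ≤ 2 * ‖L x‖ := by
    have h1 : ‖(x : UnitLp p)‖ ^ p ≤ 2 * ‖L x‖ ^ p := by
      refine le_of_tendsto (((tendsto_dyadicProj (x : UnitLp p)).comp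
        hm.tendsto_atTop).norm.rpow_const (Or.inr hp0.le)) (Eventually.of_forall fun N => ?_)
      refine (norm_dyadicProj_rpow_le_sum hp1 hp2 hm N (x : UnitLp p)).trans ?_
      rw [hnorm]
      gcongr
      exact (hsum x).sum_le_tsum _ fun k _ => by positivity
    rw [← Submodule.coe_norm] at h1
    rw [← Real.rpow_le_rpow_iff (norm_nonneg _) (by positivity) hp0,
      Real.mul_rpow zero_le_two (norm_nonneg _)]
    refine h1.trans ?_
    gcongr
    exact Real.self_le_rpow_of_one_le one_le_two hp1
  refine ⟨L.mkContinuous _ hupper, 1 / 2, D ^ p⁻¹ + 1, by norm_num, ?_, fun x => ⟨?_, hupper x⟩⟩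
  · have : 0 ≤ D ^ p⁻¹ := by positivity
    linarith
  · rw [LinearMap.mkContinuous_apply]
    linarith [hlower x]

lemma sum_dyadicBlock_le_of_forall_norm_le_one (hp : 0 < p) {X : Submodule ℝ (UnitLp p)}
    {m : ℕ → ℕ} {D : ℝ} (hD : 0 ≤ D)
    (h : ∀ x ∈ X, ‖x‖ ≤ 1 → ∀ N,
      ∑ k ∈ Finset.range N, ‖dyadicProj p (m (k + 1)) x - dyadicProj p (m k) x‖ ^ p ≤ D)
    {x : UnitLp p} (hx : x ∈ X) (N : ℕ) :
    ∑ k ∈ Finset.range N, ‖dyadicBlock p m k x‖ ^ p ≤ (D + 1) * ‖x‖ ^ p := by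
  rcases eq_or_ne x 0 with rfl | hx0
  · simp [hp.ne']
  have hpos : 0 < ‖x‖ := norm_pos_iff.2 hx0
  have hle : ∑ k ∈ Finset.range N, ‖dyadicBlock p m k (‖x‖⁻¹ • x)‖ ^ p ≤ D + 1 := by
    have hn : ‖‖x‖⁻¹ • x‖ ≤ 1 := by
      rw [norm_smul, norm_inv, norm_norm, inv_mul_cancel₀ hpos.ne']
    have hX := h _ (X.smul_mem ‖x‖⁻¹ hx) hn
    cases N with
    | zero => simpa using by linarith
    | succ N =>
      rw [Finset.sum_range_succ']
      exact add_le_add (hX N)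
        (Real.rpow_le_one (norm_nonneg _) ((norm_dyadicProj_le _ _).trans hn) hp.le)
  simp only [map_smul, norm_smul, norm_inv, norm_norm,
    Real.mul_rpow (inv_nonneg.2 hpos.le) (norm_nonneg _)] at hle
  rwa [← Finset.mul_sum, Real.inv_rpow hpos.le, inv_mul_le_iff₀ (by positivity),
    mul_comm] at hle

end BlockEmbedding

/-- Corollary 1.6(i): for `p ∈ (1,2)`, if a closed subspace `X` of
`L_p(0,1)` admits a weakly sequentially continuous coarse map into `ℓ_p` satisfying
Property (*), then `X` is isomorphic to a subspace of `ℓ_p`. -/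
theorem stmt3 (p : ℝ) (hp1 : 1 < p) (hp2 : p < 2) [Fact (1 ≤ ENNReal.ofReal p)]
    (X : Subspace ℝ (Lp ℝ (ENNReal.ofReal p) (volume.restrict (Set.Ioo (0:ℝ) 1))))
    (hXclosed : IsClosed (X : Set (Lp ℝ (ENNReal.ofReal p) (volume.restrict (Set.Ioo (0:ℝ) 1)))))
    (f : X → lp (fun _ : ℕ => ℝ) (ENNReal.ofReal p))
    (hwsc : WeakSeqCont f) (hcoarse : Coarse f) (hstar : PropertyStar f) :
    ∃ (T : X →L[ℝ] lp (fun _ : ℕ => ℝ) (ENNReal.ofReal p)) (c C : ℝ),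
      0 < c ∧ c ≤ C ∧ ∀ x : X, c * ‖x‖ ≤ ‖T x‖ ∧ ‖T x‖ ≤ C * ‖x‖ := by
  obtain ⟨α, β, b, hα, hαβ, hb0, hb⟩ := hstar
  obtain ⟨δ, hδ, hS⟩ := exists_pos_frequently_lt_norm_sub_inclLp hp1 hp2 hwsc hcoarse hb0 hb
  obtain ⟨c, hc, hAUC⟩ := exists_pos_frequently_add_mul_norm_sub_le hp1 hp2.le hα hδ
    (fun w hw => hS w (fun n => (hw n).ge) (fun n => (hw n).trans_le hαβ.le))
  obtain ⟨m, D, hm, hD, hsum⟩ :=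
    AsymptoticLowerEstimate.exists_strictMono_sum_le hp1 hp2.le hXclosed hc hAUC
  exact exists_embedding_of_sum_dyadicBlock_le hp1.le hp2.le hm (add_nonneg hD zero_le_one)
    fun x hx N => sum_dyadicBlock_le_of_forall_norm_le_one (zero_lt_one.trans hp1) hD hsum hx N
end
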